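/- Let k ≥ 3 be an integer and H be a k-graph. Then there exists an integer n_0 = n_0(H) such that, for all n ≥ n_0 satisfying n ≡ 0 (mod k-1), we have R(C_{n,1}^{(k)}, H) ≤ (χ(H)-1)(n-1) + 4k·C(χ(H)-1, 2) + τ(k-1, σ(H)) + 1, where C(·,·) denotes the binomial coefficient. -/

import Mathlib

open scoped Classical

/-- There is a copy of the hypergraph with edge set `F` all of whose edges receive
colour `b` under the red/blue colouring `c` (`true` = red, `false` = blue) of the
complete hypergraph on the vertex type `V`. -/
def hasMonoCopy {V W : Type*} [DecidableEq V] [DecidableEq W]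
    (c : Finset V → Bool) (b : Bool) (F : Finset (Finset W)) : Prop :=
  ∃ f : W → V, Function.Injective f ∧ ∀ e ∈ F, c (e.image f) = b

/-- The Ramsey number of a pair of hypergraphs: the least `N` such that every
red/blue colouring of the complete hypergraph on `N` vertices contains a red copy
of `G` or a blue copy of `H`. -/
noncomputable def ramseyNumber {V W : Type*} [DecidableEq V] [DecidableEq W]
    (G : Finset (Finset V)) (H : Finset (Finset W)) : ℕ :=
  sInf {N : ℕ | ∀ c : Finset (Fin N) → Bool,
    hasMonoCopy c true G ∨ hasMonoCopy c false H}

/-- `E` is a `k`-uniform hypergraph: every edge has exactly `k` vertices. -/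
def IsUniformHyp {V : Type*} (k : ℕ) (E : Finset (Finset V)) : Prop :=
  ∀ e ∈ E, e.card = k
/-- A vertex colouring is proper if no edge is monochromatic. -/
def IsProperColoring {V : Type*} {r : ℕ} (E : Finset (Finset V)) (c : V → Fin r) : Prop :=
  ∀ e ∈ E, ∃ u ∈ e, ∃ v ∈ e, c u ≠ c v

/-- The chromatic number of a hypergraph. -/
noncomputable def chromNum {V : Type*} (E : Finset (Finset V)) : ℕ :=
  sInf {r : ℕ | ∃ c : V → Fin r, IsProperColoring E c}

/-- `σ(H)`: the smallest size of a colour class over all proper colourings of `H`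
with `χ(H)` colours. -/
noncomputable def sigmaNum {V : Type*} [Fintype V] (E : Finset (Finset V)) : ℕ :=
  sInf {s : ℕ | ∃ c : V → Fin (chromNum E), IsProperColoring E c ∧
    ∃ i, s = (Finset.univ.filter (fun v => c v = i)).card}
/-- The edge set of the `k`-uniform `ℓ`-cycle on `n` vertices `0, …, n-1`
(for `n ≡ 0 (mod k-ℓ)`): the `i`-th edge consists of the vertices
`i(k-ℓ), …, i(k-ℓ)+k-1`, with indices taken modulo `n`. -/
def ellCycleEdges (k ℓ n : ℕ) : Finset (Finset (Fin n)) :=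
  (Finset.range (n / (k - ℓ))).image (fun i =>
    Finset.univ.filter (fun v : Fin n => ∃ j < k, (v : ℕ) = (i * (k - ℓ) + j) % n))
/-- The independence number of a hypergraph: the largest size of a vertex set
containing no edge. -/
noncomputable def indepNum {V : Type*} [Fintype V] (E : Finset (Finset V)) : ℕ :=
  Finset.sup (Finset.univ.filter (fun S : Finset V => ∀ e ∈ E, ¬ e ⊆ S)) Finset.card

/-- `E` contains no loose path of length two, i.e. no two (distinct) edges sharing
exactly one vertex. -/
def NoLoosePathTwo {V : Type*} [DecidableEq V] (E : Finset (Finset V)) : Prop :=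
  ∀ e ∈ E, ∀ f ∈ E, e ≠ f → (e ∩ f).card ≠ 1

/-- `τ(k, α)`: the largest `n` such that there is a `k`-uniform hypergraph on `n`
vertices with independence number less than `α` and no loose path of length two. -/
noncomputable def tauFn (k α : ℕ) : ℕ :=
  sSup {n : ℕ | ∃ E : Finset (Finset (Fin n)),
    IsUniformHyp k E ∧ indepNum E < α ∧ NoLoosePathTwo E}


namespace LC
open Finset

def Clq {V : Type*} [DecidableEq V] (k : ℕ) (red : Finset V → Prop) (Q : Finset V) : Prop :=
  ∀ e ⊆ Q, e.card = k → red e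

inductive Pth {V : Type*} [DecidableEq V] (k : ℕ) (red : Finset V → Prop) :
    V → V → Finset V → Prop
  | single (x : V) : Pth k red x x {x}
  | cons {x z y : V} {A c : Finset V} : Pth k red z y A → x ∉ A → x ∉ c → Disjoint c A →
      c.card + 2 = k → red (insert x (insert z c)) → Pth k red x y (insert x (c ∪ A))

section
variable {V : Type*} [DecidableEq V] {k : ℕ} {red : Finset V → Prop}

lemma Clq.mono {Q Q' : Finset V} (h : Clq k red Q) (hs : Q' ⊆ Q) : Clq k red Q' :=
  fun e he hc => h e (he.trans hs) hc

lemma Pth.left_mem {x y : V} {A : Finset V} (h : Pth k red x y A) : x ∈ A := by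
  cases h <;> simp

lemma Pth.right_mem {x y : V} {A : Finset V} (h : Pth k red x y A) : y ∈ A := by
  induction h <;> simp_all

lemma Pth.card_eq {x y : V} {A : Finset V} (h : Pth k red x y A) :
    ∃ t, A.card = t * (k - 1) + 1 := by
  induction h with
  | single x => exact ⟨0, by simp⟩
  | @cons x z y A c hp hx hxc hd hc hr ih =>
    obtain ⟨t, ht⟩ := ih
    refine ⟨t + 1, ?_⟩
    rw [card_insert_of_notMem (by simp [hx, hxc]), card_union_of_disjoint hd, ht, add_mul]
    omega

lemma Pth.eq_single {x : V} {A : Finset V} (h : Pth k red x x A) : A = {x} := by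
  cases h with
  | single => rfl
  | cons hp hx => exact absurd hp.right_mem hx

lemma Pth.trans {x y w : V} {A B : Finset V} (h : Pth k red x y A) (h' : Pth k red y w B)
    (hAB : ∀ v ∈ A, v ∈ B → v = y) : Pth k red x w (A ∪ B) := by
  induction h with
  | single x =>
    have : ({x} : Finset V) ∪ B = B := by
      rw [union_eq_right]; simpa using h'.left_mem
    rw [this]; exact h'
  | @cons x z y A c hp hx hxc hd hc hr ih =>
    have e : insert x (c ∪ A) ∪ B = insert x (c ∪ (A ∪ B)) := by
      rw [insert_union, union_assoc]
    rw [e]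
    have hy := hp.right_mem
    refine Pth.cons (ih h' (fun v hv hv' => hAB v (by simp [hv]) hv')) ?_ hxc ?_ hc hr
    · simp only [mem_union, not_or]
      refine ⟨hx, fun hxB => hx ?_⟩
      have := hAB x (by simp) hxB
      rwa [this]
    · rw [disjoint_union_right]
      refine ⟨hd, disjoint_left.2 fun v hv hvB => ?_⟩
      have := hAB v (by simp [hv]) hvB
      subst this
      exact disjoint_left.1 hd hv hy

lemma Pth.edge {x y : V} {e : Finset V} (hr : red e) (hk : e.card = k) (hxy : x ≠ y)
    (hx : x ∈ e) (hy : y ∈ e) : Pth k red x y e := by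
  have h1 : insert x (insert y ((e.erase x).erase y)) = e := by
    rw [insert_erase (by simp [hy, hxy.symm]), insert_erase hx]
  have h2 : insert x (((e.erase x).erase y) ∪ {y}) = e := by
    conv_rhs => rw [← h1]
    rw [union_comm, ← insert_eq]
  rw [← h2]
  refine Pth.cons (z := y) (Pth.single y) (by simpa using hxy) (by simp) (by simp) ?_ (by rwa [h1])
  have h3 := card_erase_of_mem hx
  have h4 := card_erase_of_mem (s := e.erase x) (a := y) (by simp [hy, hxy.symm])
  have h5 : 1 < e.card := one_lt_card.2 ⟨x, hx, y, hy, hxy⟩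
  omega

lemma Pth.symm {x y : V} {A : Finset V} (h : Pth k red x y A) : Pth k red y x A := by
  induction h with
  | single x => exact Pth.single x
  | @cons x z y A c hp hx hxc hd hc hr ih =>
    have hz := hp.left_mem
    have hxz : x ≠ z := fun h => hx (h ▸ hz)
    have hzc : z ∉ c := fun h => disjoint_left.1 hd h hz
    have hcard : (insert x (insert z c)).card = k := by
      rw [card_insert_of_notMem (by simp [hxz, hxc]), card_insert_of_notMem hzc]; omega
    have he : Pth k red z x (insert x (insert z c)) :=
      Pth.edge hr hcard hxz.symm (by simp) (by simp)
    have := ih.trans he (by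
      intro v hv hv'
      simp only [mem_insert] at hv'
      rcases hv' with rfl | rfl | h
      · exact absurd hv hx
      · rfl
      · exact absurd hv (disjoint_left.1 hd h))
    convert this using 1
    ext v; simp only [mem_insert, mem_union]
    constructor
    · tauto
    · rintro (h | h | rfl | h) <;> tauto

lemma Pth.clique (hk : 3 ≤ k) {t : ℕ} : ∀ {Q : Finset V} {x y : V}, Clq k red Q → x ≠ y → x ∈ Q →
    y ∈ Q → Q.card = t * (k - 1) + 1 → Pth k red x y Q := by
  induction t with
  | zero =>
    intro Q x y _ hxy hx hy hc
    have : 1 < Q.card := one_lt_card.2 ⟨x, hx, y, hy, hxy⟩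
    omega
  | succ t ih =>
    intro Q x y hQ hxy hx hy hc
    rcases Nat.eq_zero_or_pos t with rfl | ht
    · exact Pth.edge (hQ Q subset_rfl (by omega)) (by omega) hxy hx hy
    · have hge : k - 1 ≤ t * (k - 1) := Nat.le_mul_of_pos_left _ ht
      rw [add_mul] at hc
      have h3 := card_erase_of_mem hx
      have h4 := card_erase_of_mem (s := Q.erase x) (a := y) (by simp [hy, hxy.symm])
      obtain ⟨d, hd, hdc⟩ := exists_subset_card_eq (s := (Q.erase x).erase y) (n := k - 1) (by omega)
      obtain ⟨z, hz⟩ : d.Nonempty := card_pos.1 (by omega)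
      have hdQ : ∀ v ∈ d, v ≠ x ∧ v ≠ y ∧ v ∈ Q := by
        intro v hv; have := hd hv; simp at this; tauto
      set c := d.erase z with hcdef
      have hcc : c.card = k - 2 := by rw [card_erase_of_mem hz]; omega
      have hcd : c ⊆ d := erase_subset _ _
      have hsub : c ⊆ Q.erase x := fun v hv => by
        have := hdQ v (hcd hv); simp; tauto
      have e : insert x (c ∪ ((Q.erase x) \ c)) = Q := by
        rw [union_sdiff_of_subset hsub, insert_erase hx]
      rw [← e]
      have hzQ := hdQ z hz
      refine Pth.cons (z := z) (ih (hQ.mono (sdiff_subset.trans (erase_subset _ _))) hzQ.2.1 ?_ ?_ ?_) ?_ ?_ ?_ ?_ ?_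
      · simp [c]; tauto
      · simp only [mem_sdiff, mem_erase]
        exact ⟨⟨hxy.symm, hy⟩, fun h => (hdQ y (hcd h)).2.1 rfl⟩
      · rw [card_sdiff_of_subset hsub]; omega
      · simp
      · exact fun h => (hdQ x (hcd h)).1 rfl
      · exact disjoint_sdiff
      · omega
      · apply hQ
        · rw [insert_erase hz]
          exact insert_subset hx (fun v hv => (hdQ v hv).2.2)
        · rw [insert_erase hz, card_insert_of_notMem (fun h => (hdQ x h).1 rfl)]; omega

lemma Pth.join {x y z w : V} {A B c : Finset V} (h : Pth k red x y A) (h' : Pth k red z w B)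
    (hAB : Disjoint A B) (hcA : Disjoint c A) (hcB : Disjoint c B) (hc : c.card + 2 = k)
    (hr : red (insert y (insert z c))) : Pth k red x w (A ∪ c ∪ B) := by
  have hy := h.right_mem
  have h2 := Pth.cons h' (disjoint_left.1 hAB hy) (fun h => disjoint_left.1 hcA h hy) hcB hc hr
  have h3 := h.trans h2 (by
    intro v hv hv'
    simp only [mem_insert, mem_union] at hv'
    rcases hv' with h | h | h
    · exact h
    · exact absurd hv (disjoint_left.1 hcA h)
    · exact absurd h (disjoint_left.1 hAB hv))
  convert h3 using 1
  ext v; simp only [mem_insert, mem_union]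
  constructor
  · tauto
  · rintro (h | rfl | h) <;> tauto

lemma Pth.split (hk : 3 ≤ k) {x y : V} {A : Finset V} (h : Pth k red x y A) :
    ∀ t, t * (k - 1) + 1 ≤ A.card → ∃ z A1 A2, Pth k red x z A1 ∧ Pth k red z y A2 ∧
      A1 ∪ A2 = A ∧ (∀ v ∈ A1, v ∈ A2 → v = z) ∧ A1.card = t * (k - 1) + 1 := by
  induction h with
  | single x =>
    intro t ht
    rw [card_singleton] at ht
    have : t * (k - 1) = 0 := by omega
    exact ⟨x, {x}, {x}, Pth.single x, Pth.single x, by simp, by simp, by simp [this]⟩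
  | @cons x z y A c hp hx hxc hd hc hr ih =>
    intro t ht
    rcases t with _ | t
    · exact ⟨x, {x}, _, Pth.single x, Pth.cons hp hx hxc hd hc hr, by simp, by simp, by simp⟩
    · have hcard : (insert x (c ∪ A)).card = A.card + (k - 1) := by
        rw [card_insert_of_notMem (by simp [hx, hxc]), card_union_of_disjoint hd]; omega
      rw [add_mul] at ht
      obtain ⟨w, A1, A2, h1, h2, h3, h4, h5⟩ := ih t (by omega)
      have hA1 : A1 ⊆ A := h3 ▸ subset_union_left
      have hA2 : A2 ⊆ A := h3 ▸ subset_union_right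
      refine ⟨w, insert x (c ∪ A1), A2, Pth.cons h1 (fun h => hx (hA1 h)) hxc
        (disjoint_of_subset_right hA1 hd) hc hr, h2, ?_, ?_, ?_⟩
      · rw [insert_union, union_assoc, h3]
      · intro v hv hv2
        simp only [mem_insert, mem_union] at hv
        rcases hv with rfl | h | h
        · exact absurd (hA2 hv2) hx
        · exact absurd (hA2 hv2) (disjoint_left.1 hd h)
        · exact h4 v h hv2
      · rw [card_insert_of_notMem, card_union_of_disjoint (disjoint_of_subset_right hA1 hd), add_mul]
        · omega
        · simp only [mem_union, not_or]; exact ⟨hxc, fun h => hx (hA1 h)⟩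

lemma Pth.last {x y : V} {A : Finset V} (h : Pth k red x y A) (Q : Finset V) :
    (Q ∩ A).Nonempty → ∃ q ∈ Q, ∃ A1 ⊆ A, Pth k red q y A1 ∧ (A1 ∩ Q).card + 1 ≤ k ∨ 
      (q = y ∧ A1 = {y} ∧ Pth k red q y A1) := by
  induction h with
  | single x =>
    rintro ⟨q, hq⟩
    simp only [mem_inter, mem_singleton] at hq
    obtain ⟨hq, rfl⟩ := hq
    exact ⟨q, hq, {q}, by simp, Or.inr ⟨rfl, rfl, Pth.single q⟩⟩
  | @cons x z y A c hp hx hxc hd hc hr ih =>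
    intro hne
    by_cases hA : (Q ∩ A).Nonempty
    · obtain ⟨q, hq, A1, hA1, h⟩ := ih hA
      have : A ⊆ insert x (c ∪ A) := subset_union_right.trans (subset_insert _ _)
      exact ⟨q, hq, A1, hA1.trans this, h⟩
    · have hA' : ∀ v ∈ A, v ∉ Q := fun v hv hvQ => hA ⟨v, by simp [hv, hvQ]⟩
      obtain ⟨q, hq⟩ := hne
      simp only [mem_inter, mem_insert, mem_union] at hq
      obtain ⟨hqQ, hq⟩ := hq
      have hz := hp.left_mem
      have hxz : x ≠ z := fun h => hx (h ▸ hz)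
      have hzc : z ∉ c := fun h => disjoint_left.1 hd h hz
      have hcard : (insert x (insert z c)).card = k := by
        rw [card_insert_of_notMem (by simp [hxz, hxc]), card_insert_of_notMem hzc]; omega
      have hqz : q ≠ z := fun h => hA' z hz (h ▸ hqQ)
      have hqe : q ∈ insert x (insert z c) := by
        simp only [mem_insert]
        rcases hq with h | h | h
        · exact Or.inl h
        · exact Or.inr (Or.inr h)
        · exact absurd hqQ (hA' q h)
      have he : Pth k red q z (insert x (insert z c)) := Pth.edge hr hcard hqz hqe (by simp)
      have h2 := he.trans hp (by
        intro v hv hv'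
        simp only [mem_insert] at hv
        rcases hv with rfl | rfl | h
        · exact absurd hv' hx
        · rfl
        · exact absurd hv' (disjoint_left.1 hd h))
      refine ⟨q, hqQ, _, ?_, Or.inl ⟨h2, ?_⟩⟩
      · intro v; simp only [mem_insert, mem_union]
        rintro ((h | rfl | h) | h) <;> tauto
      · have : (insert x (insert z c) ∪ A) ∩ Q ⊆ insert x c := by
          intro v; simp only [mem_insert, mem_union, mem_inter]
          rintro ⟨(h | rfl | h) | h, hQ⟩
          · exact Or.inl h
          · exact absurd hQ (hA' _ hz)
          · exact Or.inr h
          · exact absurd hQ (hA' _ h)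
        have := card_le_card this
        rw [card_insert_of_notMem hxc] at this
        omega

lemma Pth.last' (hk : 3 ≤ k) {x y : V} {A : Finset V} (h : Pth k red x y A) (Q : Finset V) 
    (hne : (Q ∩ A).Nonempty) : ∃ q ∈ Q, ∃ A1 ⊆ A, Pth k red q y A1 ∧ (A1 ∩ Q).card + 1 ≤ k := by
  obtain ⟨q, hq, A1, h⟩ := h.last Q hne
  rcases h with ⟨h1, h2⟩
  rcases h2 with ⟨h, h'⟩ | ⟨rfl, rfl, h⟩
  · exact ⟨q, hq, A1, h1, h, h'⟩
  · refine ⟨q, hq, _, h1, h, ?_⟩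
    have := card_le_card (inter_subset_left : {q} ∩ Q ⊆ {q})
    simp only [card_singleton] at this
    omega

lemma Pth.trim (hk : 3 ≤ k) {x y : V} {A : Finset V} (h : Pth k red x y A) :
    ∃ B ⊆ A, x ∉ B ∧ (B = ∅ ∨ ∃ x' y', Pth k red x' y' B) ∧ A.card ≤ B.card + k - 1 := by
  cases h with
  | single x => exact ⟨∅, by simp, by simp, Or.inl rfl, by simp; omega⟩
  | @cons _ z _ A c hp hx hxc hd hc hr =>
    refine ⟨A, subset_union_right.trans (subset_insert _ _), hx, Or.inr ⟨_, _, hp⟩, ?_⟩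
    rw [card_insert_of_notMem (by simp [hx, hxc]), card_union_of_disjoint hd]; omega

end
end LC

namespace LC
open Finset

def HasCyc {V : Type*} [DecidableEq V] (k : ℕ) (red : Finset V → Prop) (n : ℕ) : Prop :=
  ∃ u v A C, u ≠ v ∧ Pth k red u v A ∧ Disjoint A C ∧ C.card + 2 = k ∧
    red (insert u (insert v C)) ∧ A.card + C.card = n

inductive ES {V : Type*} [DecidableEq V] (k : ℕ) (red : Finset V → Prop) (W : Finset V) :
    ℕ → Finset V → Prop
  | nil : ES k red W 0 ∅
  | cons {g : ℕ} {E A : Finset V} {u v : V} : ES k red W g E → Pth k red u v A → u ∈ W → v ∈ W →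
      Disjoint A E → ES k red W (g + 1) (E ∪ A)

section
variable {V : Type*} [DecidableEq V] {k : ℕ} {red : Finset V → Prop}

lemma Pth.toList (hk : 3 ≤ k) {x y : V} {A : Finset V} (h : Pth k red x y A) :
    ∃ l : List V, l.Nodup ∧ l.toFinset = A ∧ l.length = A.card ∧ l.head? = some x ∧
      l.getLast? = some y ∧
      ∀ i, i * (k - 1) + k ≤ A.card → red ((l.drop (i * (k - 1))).take k).toFinset := by
  induction h with
  | single x =>
    refine ⟨[x], by simp, by simp, by simp, by simp, by simp, ?_⟩
    intro i hi; simp at hi; omega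
  | @cons x z y A c hp hx hxc hd hc hr ih =>
    obtain ⟨l, h1, h2, h3, h4, h5, h6⟩ := ih
    have hcard : (insert x (c ∪ A)).card = A.card + (k - 1) := by
      rw [card_insert_of_notMem (by simp [hx, hxc]), card_union_of_disjoint hd]; omega
    have hcl : c.toList.length = k - 2 := by rw [length_toList]; omega
    obtain ⟨l', rfl⟩ : ∃ l', l = z :: l' := by
      cases l with
      | nil => simp at h4
      | cons a l' => simp at h4; exact ⟨l', by rw [h4]⟩
    refine ⟨x :: (c.toList ++ z :: l'), ?_, ?_, ?_, by simp, ?_, ?_⟩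
    · rw [List.nodup_cons, List.nodup_append]
      refine ⟨?_, nodup_toList c, h1, ?_⟩
      · rw [List.mem_append, ← List.mem_toFinset (l := z :: l'), h2]; simp [hx, hxc]
      · intro a ha b hb hab
        subst hab
        rw [← List.mem_toFinset, h2] at hb
        exact disjoint_left.1 hd (by simpa using ha) hb
    · rw [List.toFinset_cons, List.toFinset_append, h2]; simp
    · rw [hcard, List.length_cons, List.length_append, h3, hcl]; omega
    · rw [← List.cons_append, List.getLast?_append, h5]; simp
    · intro i hi
      rcases i with _ | i
      · have : ((x :: (c.toList ++ z :: l')).drop (0 * (k-1))).take k = x :: (c.toList ++ [z]) := by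
          obtain ⟨d, rfl⟩ : ∃ d, k = d + 2 := ⟨k - 2, by omega⟩
          simp only [zero_mul, List.drop_zero, List.take_succ_cons]
          rw [List.take_append]
          simp at hcl
          simp [hcl]
        rw [this]
        convert hr using 1
        ext v; simp
      · have : ((x :: (c.toList ++ z :: l')).drop ((i+1) * (k-1))) = (z :: l').drop (i * (k-1)) := by
          have e : (i+1) * (k-1) = ((x :: c.toList).length) + i * (k-1) := by
            rw [List.length_cons, hcl, add_mul]; omega
          rw [e, ← List.cons_append, List.drop_append, List.drop_eq_nil_of_le (by omega)]
          simp
        rw [this]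
        apply h6
        rw [hcard, add_mul] at hi; omega

lemma HasCyc.copy (hk : 3 ≤ k) {n : ℕ} (hn : (k - 1) ∣ n) {c : Finset V → Bool}
    (h : HasCyc k (fun e => c e = true) n) : hasMonoCopy c true (ellCycleEdges k 1 n) := by
  obtain ⟨u, v, A, C, huv, hP, hd, hC, hr, hcard⟩ := h
  obtain ⟨t, ht⟩ := hP.card_eq
  obtain ⟨l, h1, h2, h3, h4, h5, h6⟩ := hP.toList hk
  have hn' : n = (t + 1) * (k - 1) := by rw [add_mul]; omega
  have hCl : C.toList.length = k - 2 := by rw [length_toList]; omega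
  set L := l ++ C.toList with hL
  have hLlen : L.length = n := by rw [hL, List.length_append, h3, hCl]; omega
  have hLnd : L.Nodup := by
    rw [hL, List.nodup_append]
    refine ⟨h1, nodup_toList C, ?_⟩
    intro a ha b hb hab
    subst hab
    rw [← List.mem_toFinset, h2] at ha
    exact disjoint_left.1 hd ha (by simpa using hb)
  have hnpos : 0 < n := by rw [hn', add_mul]; omega
  refine ⟨fun i => L.get (i.cast hLlen.symm), ?_, ?_⟩
  · intro i j hij
    have := (List.nodup_iff_injective_get.1 hLnd) hij
    simpa using this
  · intro e he
    simp only [ellCycleEdges, mem_image, mem_range] at he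
    obtain ⟨i, hi, rfl⟩ := he
    have hdiv : n / (k - 1) = t + 1 := by rw [hn']; exact Nat.mul_div_cancel _ (by omega)
    rw [hdiv] at hi
    rcases Nat.lt_succ_iff_lt_or_eq.1 hi with hi | rfl
    · have hle : i * (k - 1) + k ≤ A.card := by
        have : (i + 1) * (k - 1) ≤ t * (k - 1) := Nat.mul_le_mul_right _ hi
        rw [add_mul] at this; omega
      have h7 := h6 i hle
      convert h7 using 2
      ext x
      simp only [mem_image, mem_filter, mem_univ, true_and, List.mem_toFinset]
      rw [List.mem_iff_getElem]
      constructor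
      · rintro ⟨a, ⟨j, hj, ha⟩, rfl⟩
        rw [Nat.mod_eq_of_lt (by omega)] at ha
        refine ⟨j, by simp; omega, ?_⟩
        simp only [List.getElem_take, List.getElem_drop, List.get_eq_getElem, Fin.val_cast, ha, L]
        rw [List.getElem_append_left]
      · rintro ⟨j, hj, rfl⟩
        simp at hj
        refine ⟨⟨i * (k-1) + j, by omega⟩, ⟨j, by omega, (Nat.mod_eq_of_lt (by omega)).symm⟩, ?_⟩
        simp only [List.getElem_take, List.getElem_drop, List.get_eq_getElem, Fin.val_cast, L]
        rw [List.getElem_append_left]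
    · convert hr using 2
      have hlv : ∀ h : i * (k-1) < L.length, L[i * (k-1)] = v := by
        intro h
        have : l[l.length - 1]? = some v := by rw [← List.getLast?_eq_getElem?, h5]
        simp only [L]
        rw [List.getElem_append_left (by omega)]
        have e : l.length - 1 = i * (k-1) := by omega
        rw [e] at this
        rw [List.getElem?_eq_some_iff] at this
        exact this.2
      have hlu : ∀ h : 0 < L.length, L[0] = u := by
        intro h
        have : l[0]? = some u := by rw [← List.head?_eq_getElem?, h4]
        simp only [L]
        rw [List.getElem_append_left (by omega)]
        rw [List.getElem?_eq_some_iff] at this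
        exact this.2
      have hlc : ∀ j, ∀ h : i * (k-1) + (j+1) < L.length, ∀ h' : j < C.toList.length, L[i * (k-1) + (j+1)] = C.toList[j] := by
        intro j h h'
        simp only [L]
        rw [List.getElem_append_right (by omega)]
        congr 1; omega
      have hn2 : n = i * (k-1) + (k-1) := by rw [hn', add_mul]; omega
      ext x
      simp only [mem_image, mem_filter, mem_univ, true_and, mem_insert]
      constructor
      · rintro ⟨a, ⟨j, hj, ha⟩, rfl⟩
        simp only [List.get_eq_getElem, Fin.val_cast, ha]
        rcases Nat.lt_or_ge j (k-1) with hj' | hj'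
        · simp only [Nat.mod_eq_of_lt (show i * (k-1) + j < n by omega)]
          rcases j with _ | j
          · right; left; exact hlv _
          · right; right; rw [hlc j (by omega) (by omega)]
            exact mem_toList.1 (List.getElem_mem _)
        · left
          have : i * (k-1) + j = n := by omega
          simp only [this, Nat.mod_self]
          exact hlu _
      · rintro (rfl | rfl | hx)
        · exact ⟨⟨0, hnpos⟩, ⟨k-1, by omega, by rw [← hn2]; simp⟩, hlu _⟩
        · exact ⟨⟨i*(k-1), by omega⟩, ⟨0, by omega, (Nat.mod_eq_of_lt (by omega)).symm⟩, hlv _⟩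
        · rw [← mem_toList, List.mem_iff_getElem] at hx
          obtain ⟨j, hj, rfl⟩ := hx
          exact ⟨⟨i*(k-1)+(j+1), by omega⟩, ⟨j+1, by omega, (Nat.mod_eq_of_lt (by omega)).symm⟩, 
            hlc j _ _⟩

lemma ES.mono {W W' E : Finset V} {g : ℕ} (h : ES k red W g E) (hW : W ⊆ W') : ES k red W' g E := by
  induction h with
  | nil => exact ES.nil
  | cons h hp hu hv hd ih => exact ES.cons ih hp (hW hu) (hW hv) hd

lemma ES.card_eq {W E : Finset V} {g : ℕ} (h : ES k red W g E) :
    ∃ t, E.card = t * (k - 1) + g := by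
  induction h with
  | nil => exact ⟨0, by simp⟩
  | cons h hp hu hv hd ih =>
    obtain ⟨t, ht⟩ := ih
    obtain ⟨s, hs⟩ := hp.card_eq
    exact ⟨t + s, by rw [card_union_of_disjoint hd.symm, ht, hs]; ring⟩

lemma ES.add {W E : Finset V} {g : ℕ} (h : ES k red W g E) : ∀ S : Finset V, S ⊆ W → Disjoint S E →
    ES k red W (g + S.card) (E ∪ S) := by
  intro S
  induction S using Finset.induction_on with
  | empty => intro _ _; simpa using h
  | insert a S ha ih =>
    intro hS hd
    rw [card_insert_of_notMem ha, ← add_assoc, show E ∪ insert a S = (E ∪ S) ∪ {a} by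
      ext v; simp only [mem_insert, mem_union, mem_singleton]; tauto]
    rw [disjoint_insert_left] at hd
    refine ES.cons (ih ((subset_insert _ _).trans hS) hd.2) (Pth.single a) (hS (by simp)) (hS (by simp)) ?_
    simp [ha, hd.1]

lemma ES.chain {W E : Finset V} {g : ℕ} (hW : Clq k red W) (h : ES k red W g E) (hk : 3 ≤ k) :
    ∀ H : Finset V, 1 ≤ g → H ⊆ W → Disjoint H E → H.card = (g - 1) * (k - 2) →
    ∃ u ∈ W, ∃ v ∈ W, Pth k red u v (E ∪ H) := by
  induction h with
  | nil => intro H hg; omega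
  | @cons g E A u v h hp hu hv hd ih =>
    intro H _ hHW hHd hH
    rcases g with _ | g
    · have : H = ∅ := by simpa using hH
      subst this
      cases h
      exact ⟨u, hu, v, hv, by simpa using hp⟩
    · have hH' : H.card = g * (k-2) + (k-2) := by rw [hH]; simp [add_mul]
      obtain ⟨c, hcH, hc⟩ := exists_subset_card_eq (s := H) (n := k - 2) (by omega)
      rw [disjoint_union_right] at hHd
      obtain ⟨u', hu', v', hv', hp'⟩ := ih (H \ c) (by omega) (sdiff_subset.trans hHW)
        (disjoint_of_subset_left sdiff_subset hHd.1) (by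
          rw [card_sdiff_of_subset hcH, hH', hc]; simp)
      refine ⟨u', hu', v, hv, ?_⟩
      have hdA : Disjoint (E ∪ H \ c) A := by
        rw [disjoint_union_left]
        exact ⟨hd.symm, disjoint_of_subset_left sdiff_subset hHd.2⟩
      have hdc : Disjoint c (E ∪ H \ c) := by
        rw [disjoint_union_right]
        exact ⟨disjoint_of_subset_left hcH hHd.1, disjoint_sdiff⟩
      have hdcA : Disjoint c A := disjoint_of_subset_left hcH hHd.2
      have huA := hp.left_mem
      have hv'A := hp'.right_mem
      have := hp'.join hp hdA hdc hdcA (by omega) (by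
        apply hW
        · exact insert_subset hv' (insert_subset hu (hcH.trans hHW))
        · rw [card_insert_of_notMem, card_insert_of_notMem]
          · omega
          · exact fun h => disjoint_left.1 hdcA h huA
          · simp only [mem_insert, not_or]
            exact ⟨fun h => disjoint_left.1 hdA hv'A (h ▸ huA), fun h => disjoint_left.1 hdc h hv'A⟩)
      convert this using 1
      ext x
      simp only [mem_union, mem_sdiff]
      by_cases hx : x ∈ c
      · have := hcH hx; tauto
      · tauto

lemma ES.cyc {W E H : Finset V} {g n : ℕ} (hk : 3 ≤ k) (hW : Clq k red W) (h : ES k red W g E)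
    (hHW : H ⊆ W) (hHE : Disjoint H E) (hn : (k - 1) ∣ n) (h1 : E.card + g * (k - 2) ≤ n)
    (h2 : n ≤ E.card + H.card) (h3 : 2 * (k - 1) ≤ n) : HasCyc k red n := by
  obtain ⟨t, ht⟩ := h.card_eq
  obtain ⟨q, hq⟩ := hn
  obtain ⟨d, rfl⟩ : ∃ d, k = d + 2 := ⟨k - 2, by omega⟩
  simp only [Nat.add_sub_cancel, show d + 2 - 1 = d + 1 by omega] at *
  have hs : ∃ s, n = E.card + g * d + s * (d + 1) := by
    have e : E.card + g * d = (t + g) * (d + 1) := by rw [ht]; ring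
    rw [e, hq, mul_comm (d+1) q] at h1
    have h1' := Nat.le_of_mul_le_mul_right h1 (by omega)
    refine ⟨q - (t + g), ?_⟩
    rw [e, ← add_mul, hq, mul_comm, Nat.add_sub_cancel' h1']
  obtain ⟨s, hs⟩ := hs
  have hs' : n = E.card + s + (g + s) * d := by rw [hs]; ring
  obtain ⟨S, hSH, hS⟩ := exists_subset_card_eq (s := H) (n := s) (by omega)
  have hES := h.add S (hSH.trans hHW) (disjoint_of_subset_left hSH hHE)
  rw [hS] at hES
  have hgs : 1 ≤ g + s := by
    by_contra hh
    have : g = 0 ∧ s = 0 := by omega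
    obtain ⟨rfl, rfl⟩ := this
    cases h
    simp at hs'
    omega
  have hgd : (g + s) * d = (g + s - 1) * d + d := by
    obtain ⟨a, ha⟩ : ∃ a, g + s = a + 1 := ⟨g + s - 1, by omega⟩
    rw [ha]; simp [add_mul]
  have hHS : (H \ S).card = H.card - s := by rw [card_sdiff_of_subset hSH, hS]
  obtain ⟨T, hT, hTc⟩ := exists_subset_card_eq (s := H \ S) (n := (g + s) * d) (by omega)
  obtain ⟨C, hC, hCc⟩ := exists_subset_card_eq (s := T) (n := d) (by omega)
  have hTH : T ⊆ H := hT.trans sdiff_subset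
  have hTES : Disjoint T (E ∪ S) := by
    rw [disjoint_union_right]
    exact ⟨disjoint_of_subset_left hTH hHE, disjoint_of_subset_left hT sdiff_disjoint⟩
  obtain ⟨u, hu, v, hv, hp⟩ := hES.chain hW hk (T \ C) hgs (sdiff_subset.trans (hTH.trans hHW))
    (disjoint_of_subset_left sdiff_subset hTES) (by
      rw [card_sdiff_of_subset hC, hTc, hCc, hgd]; simp)
  have hdC : Disjoint ((E ∪ S) ∪ T \ C) C := by
    rw [disjoint_union_left]
    exact ⟨(disjoint_of_subset_left hC hTES).symm, sdiff_disjoint⟩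
  have hcard : ((E ∪ S) ∪ T \ C).card + C.card = n := by
    rw [card_union_of_disjoint (disjoint_of_subset_left sdiff_subset hTES).symm,
      card_sdiff_of_subset hC, card_union_of_disjoint (disjoint_of_subset_left hSH hHE).symm]
    omega
  have huv : u ≠ v := by
    rintro rfl
    have := hp.eq_single
    rw [this, card_singleton] at hcard
    omega
  refine ⟨u, v, _, C, huv, hp, hdC, by omega, ?_, hcard⟩
  apply hW
  · exact insert_subset hu (insert_subset hv (hC.trans (hTH.trans hHW)))
  · rw [card_insert_of_notMem, card_insert_of_notMem]
    · omega
    · exact fun h => disjoint_left.1 hdC hp.right_mem h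
    · simp only [mem_insert, not_or]
      exact ⟨huv, fun h => disjoint_left.1 hdC hp.left_mem h⟩

lemma ES.biUnion {ι : Type*} [DecidableEq ι] {W : Finset V} (E : ι → Finset V) (s : Finset ι)
    (hp : ∀ a ∈ s, ∃ u ∈ W, ∃ v ∈ W, Pth k red u v (E a))
    (hd : ∀ a ∈ s, ∀ b ∈ s, a ≠ b → Disjoint (E a) (E b)) : ES k red W s.card (s.biUnion E) := by
  induction s using Finset.induction_on with
  | empty => simpa using ES.nil
  | insert a s ha ih =>
    rw [card_insert_of_notMem ha, biUnion_insert, union_comm]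
    obtain ⟨u, hu, v, hv, h⟩ := hp a (by simp)
    refine ES.cons (ih (fun b hb => hp b (by simp [hb])) (fun b hb c hc => hd b (by simp [hb]) c (by simp [hc]))) h hu hv ?_
    rw [disjoint_biUnion_right]
    intro b hb
    exact hd a (by simp) b (by simp [hb]) (fun h => ha (h ▸ hb))

end
end LC

namespace LC
open Finset

lemma ramsey_ex (k : ℕ) : ∀ q m : ℕ, ∃ R : ℕ, ∀ (V : Type) [DecidableEq V] (red : Finset V → Prop)
    (S : Finset V), R ≤ S.card → (∃ Q ⊆ S, Q.card = q ∧ Clq k red Q) ∨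
      (∃ M ⊆ S, M.card = m ∧ ∀ e ⊆ M, e.card = k → ¬ red e) := by
  induction k with
  | zero =>
    intro q m
    refine ⟨max q m, fun V _ red S hS => ?_⟩
    by_cases h : red ∅
    · left
      obtain ⟨Q, hQ, hc⟩ := exists_subset_card_eq (s := S) (n := q) (by omega)
      refine ⟨Q, hQ, hc, fun e _ he => ?_⟩
      rw [card_eq_zero] at he; rwa [he]
    · right
      obtain ⟨Q, hQ, hc⟩ := exists_subset_card_eq (s := S) (n := m) (by omega)
      refine ⟨Q, hQ, hc, fun e _ he => ?_⟩
      rw [card_eq_zero] at he; rwa [he]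
  | succ k ih =>
    suffices H : ∀ s q m, q + m = s → ∃ R : ℕ, ∀ (V : Type) [DecidableEq V] (red : Finset V → Prop)
      (S : Finset V), R ≤ S.card → (∃ Q ⊆ S, Q.card = q ∧ Clq (k+1) red Q) ∨
      (∃ M ⊆ S, M.card = m ∧ ∀ e ⊆ M, e.card = k+1 → ¬ red e) from fun q m => H _ q m rfl
    have key : ∀ (V : Type) [DecidableEq V] (red : Finset V → Prop) (v : V) (Q : Finset V), v ∉ Q →
        (∀ e ⊆ Q, e.card = k → red (insert v e)) → (∀ e ⊆ Q, e.card = k + 1 → red e) →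
        ∀ e ⊆ insert v Q, e.card = k + 1 → red e := by
      intro V _ red v Q hv h1 h2 e he hc
      by_cases hve : v ∈ e
      · have := h1 (e.erase v) (by rwa [← subset_insert_iff]) (by rw [card_erase_of_mem hve]; omega)
        rwa [insert_erase hve] at this
      · exact h2 e ((subset_insert_iff_of_notMem hve).1 he) hc
    intro s
    induction s with
    | zero =>
      intro q m hqm
      refine ⟨0, fun V _ red S _ => Or.inl ⟨∅, by simp, by simp; omega, ?_⟩⟩
      intro e he hc
      rw [subset_empty] at he; subst he; simp at hc
    | succ s ihs =>
      intro q m hqm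
      rcases q with _ | q
      · refine ⟨0, fun V _ red S _ => Or.inl ⟨∅, by simp, by simp, ?_⟩⟩
        intro e he hc
        rw [subset_empty] at he; subst he; simp at hc
      rcases m with _ | m
      · refine ⟨0, fun V _ red S _ => Or.inr ⟨∅, by simp, by simp, ?_⟩⟩
        intro e he hc
        rw [subset_empty] at he; subst he; simp at hc
      obtain ⟨R1, hR1⟩ := ihs q (m+1) (by omega)
      obtain ⟨R2, hR2⟩ := ihs (q+1) m (by omega)
      obtain ⟨R, hR⟩ := ih R1 R2
      refine ⟨R + 1, fun V _ red S hS => ?_⟩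
      obtain ⟨v, hv⟩ : S.Nonempty := card_pos.1 (by omega)
      have hcS := card_erase_of_mem hv
      rcases hR V (fun e => red (insert v e)) (S.erase v) (by omega) with ⟨Q, hQ, hc, hq⟩ | ⟨M, hM, hc, hq⟩
      · rcases hR1 V red Q (by omega) with ⟨Q', hQ', hc', hq'⟩ | ⟨M', hM', hc', hq'⟩
        · left
          have hv' : v ∉ Q' := fun h => by simpa using hQ (hQ' h)
          refine ⟨insert v Q', insert_subset hv ((hQ'.trans hQ).trans (erase_subset _ _)), ?_, ?_⟩
          · rw [card_insert_of_notMem hv']; omega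
          · exact key V red v Q' hv' (fun e he => hq e (he.trans hQ')) hq'
        · exact Or.inr ⟨M', (hM'.trans hQ).trans (erase_subset _ _), hc', hq'⟩
      · rcases hR2 V red M (by omega) with ⟨Q', hQ', hc', hq'⟩ | ⟨M', hM', hc', hq'⟩
        · exact Or.inl ⟨Q', (hQ'.trans hM).trans (erase_subset _ _), hc', hq'⟩
        · right
          have hv' : v ∉ M' := fun h => by simpa using hM (hM' h)
          refine ⟨insert v M', insert_subset hv ((hM'.trans hM).trans (erase_subset _ _)), ?_, ?_⟩
          · rw [card_insert_of_notMem hv']; omega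
          · exact key V (fun e => ¬ red e) v M' hv' (fun e he => hq e (he.trans hM')) hq'

lemma tau_bound {V : Type} [Fintype V] [DecidableEq V] {k α : ℕ} (hk : 2 ≤ k) (E : Finset (Finset V))
    (hu : IsUniformHyp k E) (hn : NoLoosePathTwo E)
    (hi : ∀ S : Finset V, (∀ e ∈ E, ¬ e ⊆ S) → S.card < α) : Fintype.card V ≤ α + 2 ^ α * α := by
  obtain ⟨S, hS, hmax⟩ := exists_max_image (univ.filter (fun S : Finset V => ∀ e ∈ E, ¬ e ⊆ S)) Finset.card
    ⟨∅, by
      simp only [mem_filter, mem_univ, true_and]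
      intro e he hsub
      rw [subset_empty] at hsub; subst hsub; have := hu _ he; simp at this; omega⟩
  simp only [mem_filter, mem_univ, true_and] at hS hmax
  let VT : Finset V → Finset V := fun T => univ.filter (fun v => v ∉ S ∧ insert v T ∈ E)
  have hVT : ∀ T ⊆ S, (VT T).card ≤ α := by
    intro T hT
    refine (hi _ ?_).le
    intro e he hsub
    obtain ⟨v, hv⟩ : e.Nonempty := card_pos.1 (by rw [hu _ he]; omega)
    have hv' := hsub hv
    simp only [VT, mem_filter, mem_univ, true_and] at hv'
    have h1 : e ∩ insert v T = {v} := by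
      ext w; simp only [mem_inter, mem_insert, mem_singleton]
      constructor
      · rintro ⟨hw, rfl | hw'⟩
        · rfl
        · have := hsub hw
          simp only [VT, mem_filter, mem_univ, true_and] at this
          exact absurd (hT hw') this.1
      · rintro rfl; exact ⟨hv, Or.inl rfl⟩
    refine hn e he _ hv'.2 ?_ (by rw [h1]; simp)
    intro h
    rw [← h, inter_self] at h1
    have := hu e he
    rw [h1] at this; simp at this; omega
  have hcov : (univ : Finset V) ⊆ S ∪ S.powerset.biUnion VT := by
    intro v _
    by_cases hv : v ∈ S
    · simp [hv]
    · simp only [mem_union, hv, false_or, mem_biUnion, mem_powerset]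
      have : ¬ ∀ e ∈ E, ¬ e ⊆ insert v S := by
        intro h
        have := hmax _ h
        rw [card_insert_of_notMem hv] at this; omega
      push Not at this
      obtain ⟨e, he, hes⟩ := this
      have hve : v ∈ e := by
        by_contra hve
        exact hS e he ((subset_insert_iff_of_notMem hve).1 hes)
      refine ⟨e.erase v, by rwa [← subset_insert_iff], ?_⟩
      simp only [VT, mem_filter, mem_univ, true_and]
      exact ⟨hv, by rwa [insert_erase hve]⟩
  have hSα := hi S hS
  calc Fintype.card V = (univ : Finset V).card := rfl
    _ ≤ _ := card_le_card hcov
    _ ≤ S.card + (S.powerset.biUnion VT).card := card_union_le _ _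
    _ ≤ α + S.powerset.card * α := by
        gcongr
        exact card_biUnion_le_card_mul _ _ _ (fun T hT => hVT T (mem_powerset.1 hT))
    _ ≤ α + 2 ^ α * α := by
        rw [card_powerset]; gcongr; omega

lemma tau_prop {V : Type} [DecidableEq V] {k σ : ℕ} (hk : 3 ≤ k) (U : Finset V)
    (hU : tauFn (k - 1) σ + 1 ≤ U.card) (F : Finset V → Prop)
    (hF : ∀ e ⊆ U, ∀ f ⊆ U, e.card = k - 1 → f.card = k - 1 → F e → F f → e ≠ f → (e ∩ f).card ≠ 1) :
    ∃ I ⊆ U, I.card = σ ∧ ∀ e ⊆ I, e.card = k - 1 → ¬ F e := by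
  let φ : Fin U.card ↪ V := (U.equivFin.symm.toEmbedding).trans (Function.Embedding.subtype _)
  have hφ : ∀ S : Finset (Fin U.card), S.map φ ⊆ U := by
    intro S v hv
    rw [mem_map] at hv
    obtain ⟨a, _, rfl⟩ := hv
    exact (U.equivFin.symm a).2
  let E : Finset (Finset (Fin U.card)) := univ.filter (fun e => e.card = k - 1 ∧ F (e.map φ))
  have hEu : IsUniformHyp (k - 1) E := fun e he => by simp [E] at he; exact he.1
  have hEn : NoLoosePathTwo E := by
    intro e he f hf hef
    simp only [E, mem_filter, mem_univ, true_and] at he hf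
    have := hF _ (hφ e) _ (hφ f) (by simpa using he.1) (by simpa using hf.1) he.2 hf.2
      (by simpa using hef)
    rw [← map_inter, card_map] at this
    exact this
  have hind : σ ≤ indepNum E := by
    by_contra hlt
    have hmem : U.card ∈ {n : ℕ | ∃ E : Finset (Finset (Fin n)),
      IsUniformHyp (k-1) E ∧ indepNum E < σ ∧ NoLoosePathTwo E} := ⟨E, hEu, by omega, hEn⟩
    have hb : BddAbove {n : ℕ | ∃ E : Finset (Finset (Fin n)),
      IsUniformHyp (k-1) E ∧ indepNum E < σ ∧ NoLoosePathTwo E} := by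
      refine ⟨σ + 2 ^ σ * σ, ?_⟩
      rintro n ⟨E, h1, h2, h3⟩
      have := tau_bound (α := σ) (by omega) E h1 h3 (by
        intro S hS
        refine lt_of_le_of_lt ?_ h2
        exact le_sup (f := Finset.card) (by simpa using hS))
      simpa using this
    have := le_csSup hb hmem
    simp only [tauFn] at hU
    omega
  rcases Nat.eq_zero_or_pos σ with rfl | hσ
  · refine ⟨∅, by simp, by simp, ?_⟩
    intro e he hc
    rw [subset_empty] at he; subst he; simp at hc; omega
  · rw [indepNum, Finset.le_sup_iff (by simpa using hσ)] at hind
    obtain ⟨S, hS, hSc⟩ := hind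
    simp only [mem_filter, mem_univ, true_and] at hS
    obtain ⟨I, hI, hIc⟩ := exists_subset_card_eq (s := S) (n := σ) hSc
    refine ⟨I.map φ, hφ I, by simpa using hIc, ?_⟩
    intro e he hc hFe
    obtain ⟨e', he', rfl⟩ := subset_map_iff.1 he
    exact hS e' (by simp only [E, mem_filter, mem_univ, true_and]; exact ⟨by simpa using hc, hFe⟩) (he'.trans hI)

section
variable {V : Type} [DecidableEq V] {k : ℕ} 

lemma F1 {nH : ℕ} {H : Finset (Finset (Fin nH))} (hHu : IsUniformHyp k H) {c : Finset V → Bool}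
    (hb : ¬ hasMonoCopy c false H) (S : Finset V) (hS : nH ≤ S.card) :
    ∃ e ⊆ S, e.card = k ∧ c e = true := by
  by_contra hno
  push Not at hno
  obtain ⟨f⟩ : Nonempty (Fin nH ↪ S) := Function.Embedding.nonempty_of_card_le (by simpa using hS)
  apply hb
  refine ⟨fun i => (f i : V), fun i j hij => f.injective (Subtype.ext hij), ?_⟩
  intro e he
  have hinj : Function.Injective (fun i => (f i : V)) := fun i j hij => f.injective (Subtype.ext hij)
  have := hno (e.image (fun i => (f i : V))) (by
    intro v hv; rw [mem_image] at hv; obtain ⟨i, _, rfl⟩ := hv; exact (f i).2)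
    (by rw [card_image_of_injective _ hinj]; exact hHu e he)
  simpa using this

lemma F2aux {nH χ : ℕ} {H : Finset (Finset (Fin nH))} (hHu : IsUniformHyp k H) {c : Finset V → Bool}
    (hb : ¬ hasMonoCopy c false H) (g : Fin nH → Fin χ) (hg : IsProperColoring H g)
    (T : Fin χ → Finset V) (hd : ∀ i j, i ≠ j → Disjoint (T i) (T j))
    (hc : ∀ i, (univ.filter (fun v => g v = i)).card ≤ (T i).card)
    (hcr : ∀ e : Finset V, e.card = k → (∀ v ∈ e, ∃ i, v ∈ T i) → (∀ i, ¬ e ⊆ T i) → c e = false) :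
    False := by
  have hemb : ∀ i, Nonempty ({v // g v = i} ↪ T i) := fun i =>
    Function.Embedding.nonempty_of_card_le (by simpa [Fintype.card_subtype] using hc i)
  let emb := fun i => (hemb i).some
  have hcast : ∀ w i (hi : g w = i), (emb i ⟨w, hi⟩ : V) = emb (g w) ⟨w, rfl⟩ := by
    intro w i hi; subst hi; rfl
  let f : Fin nH → V := fun v => (emb (g v) ⟨v, rfl⟩ : V)
  have hf : ∀ v, f v ∈ T (g v) := fun v => (emb (g v) ⟨v, rfl⟩).2
  have huniq : ∀ v i, f v ∈ T i → i = g v := by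
    intro v i hi
    by_contra hne
    exact disjoint_left.1 (hd _ _ hne) hi (hf v)
  have hinj : Function.Injective f := by
    intro v w hvw
    have h1 : g v = g w := huniq w _ (by rw [← hvw]; exact hf v)
    have h2 := hcast v (g w) h1
    have h3 : (emb (g w) ⟨v, h1⟩ : V) = emb (g w) ⟨w, rfl⟩ := h2.trans hvw
    have h4 := (emb (g w)).injective (Subtype.ext h3)
    simpa using h4
  apply hb
  refine ⟨f, hinj, fun e he => ?_⟩
  apply hcr
  · rw [card_image_of_injective _ hinj]; exact hHu e he
  · intro v hv
    rw [mem_image] at hv; obtain ⟨w, _, rfl⟩ := hv; exact ⟨_, hf w⟩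
  · intro i hi
    obtain ⟨u, hu, v, hv, huv⟩ := hg e he
    apply huv
    rw [← huniq u i (hi (mem_image_of_mem _ hu)), ← huniq v i (hi (mem_image_of_mem _ hv))]

lemma F2 {nH : ℕ} (hk : 3 ≤ k) (hn : 0 < nH) {H : Finset (Finset (Fin nH))} (hHu : IsUniformHyp k H) :
    0 < chromNum H ∧ ∀ {c : Finset V → Bool}
    (_ : ¬ hasMonoCopy c false H) (I : Finset V) (_ : (I.card = sigmaNum H))
    (W : Fin (chromNum H - 1) → Finset V) (_ : ∀ i j, i ≠ j → Disjoint (W i) (W j))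
    (_ : ∀ i, Disjoint I (W i))
    (_ : ∀ i, nH ≤ (W i).card)
    (_ : ∀ e : Finset V, e.card = k → (∀ v ∈ e, v ∈ I ∨ ∃ i, v ∈ W i) → ¬ e ⊆ I → (∀ i, ¬ e ⊆ W i) →
      c e = false), False := by
  have hne : {r : ℕ | ∃ c : Fin nH → Fin r, IsProperColoring H c}.Nonempty := by
    refine ⟨nH, id, fun e he => ?_⟩
    obtain ⟨u, hu, v, hv, h⟩ := one_lt_card.1 (show 1 < e.card by rw [hHu e he]; omega)
    exact ⟨u, hu, v, hv, h⟩
  obtain ⟨c0, hc0⟩ := Nat.sInf_mem hne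
  have hpos : 0 < chromNum H := (c0 ⟨0, hn⟩).pos
  refine ⟨hpos, ?_⟩
  have hne2 : {s : ℕ | ∃ c : Fin nH → Fin (chromNum H), IsProperColoring H c ∧
    ∃ i, s = (Finset.univ.filter (fun v => c v = i)).card}.Nonempty := ⟨_, c0, hc0, c0 ⟨0, hn⟩, rfl⟩
  have hmem := Nat.sInf_mem hne2
  change sigmaNum H ∈ _ at hmem
  obtain ⟨g, hg, i0, hi0⟩ := hmem
  intro c hb I hI W hd hdI hW hcr
  generalize hχ : chromNum H = χ at *
  obtain ⟨ρ, rfl⟩ : ∃ ρ, χ = ρ + 1 := ⟨χ - 1, by omega⟩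
  change ∀ i j : Fin ρ, i ≠ j → Disjoint (W i) (W j) at hd
  change ∀ i : Fin ρ, Disjoint I (W i) at hdI
  change ∀ i : Fin ρ, nH ≤ (W i).card at hW
  let T : Fin (ρ + 1) → Finset V := i0.insertNth (α := fun _ => Finset V) I W
  have hT0 : T i0 = I := by simp [T]
  have hTs : ∀ j : Fin ρ, T (i0.succAbove j) = W j := by intro j; simp [T]
  have hcases : ∀ i, i = i0 ∨ ∃ j, i = i0.succAbove j := by
    intro i
    by_cases h : i = i0
    · exact Or.inl h
    · obtain ⟨j, hj⟩ := Fin.exists_succAbove_eq h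
      exact Or.inr ⟨j, hj.symm⟩
  refine F2aux hHu hb g hg T ?_ ?_ ?_
  · intro i j hij
    rcases hcases i with rfl | ⟨i', rfl⟩ <;> rcases hcases j with rfl | ⟨j', rfl⟩
    · exact absurd rfl hij
    · rw [hT0, hTs]; exact hdI _
    · rw [hT0, hTs]; exact (hdI _).symm
    · rw [hTs, hTs]; exact hd _ _ (fun h => hij (by rw [h]))
  · intro i
    rcases hcases i with rfl | ⟨i', rfl⟩
    · rw [hT0, hI, hi0]
    · rw [hTs]; refine le_trans ?_ (hW _)
      exact (card_filter_le _ _).trans (by simp)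
  · intro e he h1 h2
    refine hcr e he ?_ ?_ ?_
    · intro v hv
      obtain ⟨i, hi⟩ := h1 v hv
      rcases hcases i with rfl | ⟨i', rfl⟩
      · left; rwa [hT0] at hi
      · right; exact ⟨i', by rwa [hTs] at hi⟩
    · rw [← hT0]; exact h2 _
    · intro i; have := h2 (i0.succAbove i); rwa [hTs] at this

end
end LC

namespace LC
open Finset

def BX {V : Type} [DecidableEq V] (k : ℕ) (red : Finset V → Prop) (r s : ℕ) : Prop :=
  ∃ W : Fin r → Finset V, (∀ i, s ≤ (W i).card) ∧ (∀ i, Clq k red (W i)) ∧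
    (∀ i j, i ≠ j → Disjoint (W i) (W j)) ∧
    ∀ e : Finset V, e.card = k → (∀ v ∈ e, ∃ i, v ∈ W i) → (∀ i, ¬ e ⊆ W i) → ¬ red e

def LabAt {V : Type} [DecidableEq V] (k : ℕ) (red : Finset V → Prop) (P X : Finset V) (l z : ℕ)
    (Q : Finset V) : Prop :=
  ∀ Z : Finset V, Z.card ≤ z → Disjoint Z Q → ∃ u ∈ P, ∃ v ∈ Q, ∃ Y, Pth k red u v Y ∧
    Y ⊆ X ∪ Q ∧ (Y ∩ Q).card ≤ k ∧ Y.card ≤ l ∧ Disjoint Y Z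

def Lab {V : Type} [DecidableEq V] {ι : Type} (k : ℕ) (red : Finset V → Prop) (P : ι → Finset V)
    (J : Finset ι) (X : Finset V) (l z q : ℕ) : Prop :=
  ∀ Q, Clq k red Q → Q.card = q → Disjoint Q X → ∃ i ∈ J, LabAt k red (P i) X l z Q

section
variable {V : Type} [DecidableEq V] {k : ℕ} {red : Finset V → Prop}

lemma LabAt.mono {P X X' Q : Finset V} {l l' z z' : ℕ} (h : LabAt k red P X l z Q) (hX : X ⊆ X')
    (hl : l ≤ l') (hz : z' ≤ z) : LabAt k red P X' l' z' Q := by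
  intro Z hZ hd
  obtain ⟨u, hu, v, hv, Y, h1, h2, h3, h4, h5⟩ := h Z (hZ.trans hz) hd
  exact ⟨u, hu, v, hv, Y, h1, h2.trans (union_subset_union_left hX), h3, h4.trans hl, h5⟩

lemma lab_base {r q z : ℕ} (P : Fin r → Finset V) (hP : ∀ i, q + r * z ≤ (P i).card)
    (hcl : ∀ i, Clq k red (P i)) (hd : ∀ i j, i ≠ j → Disjoint (P i) (P j))
    (hcr : ∀ e : Finset V, e.card = k → (∀ v ∈ e, ∃ i, v ∈ P i) → (∀ i, ¬ e ⊆ P i) → ¬ red e)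
    (hB : ¬ BX k red (r + 1) q) : Lab k red P univ (univ.biUnion P) k z q := by
  intro Q hQ hQc hQX
  by_contra hno
  have hno' : ∀ i, ¬ LabAt k red (P i) (univ.biUnion P) k z Q := fun i h => hno ⟨i, mem_univ _, h⟩
  unfold LabAt at hno'
  push Not at hno'
  choose Z hZc hZd hZ using hno'
  apply hB
  have hPX : ∀ i, P i ⊆ univ.biUnion P := fun i => subset_biUnion_of_mem P (mem_univ i)
  set ZZ := univ.biUnion Z with hZZ
  have hZZc : ZZ.card ≤ r * z := by
    have := card_biUnion_le_card_mul univ Z z (fun i _ => hZc i)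
    simpa using this
  let W : Fin (r + 1) → Finset V := Fin.cons (α := fun _ => Finset V) Q (fun i => P i \ ZZ)
  have hW0 : W 0 = Q := rfl
  have hWs : ∀ i : Fin r, W i.succ = P i \ ZZ := fun i => rfl
  have hdQ : ∀ i, Disjoint Q (P i) := fun i => disjoint_of_subset_right (hPX i) hQX
  refine ⟨W, ?_, ?_, ?_, ?_⟩
  · intro i
    refine Fin.cases ?_ (fun i => ?_) i
    · rw [hW0, hQc]
    · rw [hWs]
      have := le_card_sdiff ZZ (P i)
      have := hP i
      omega
  · intro i
    refine Fin.cases ?_ (fun i => ?_) i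
    · rwa [hW0]
    · rw [hWs]; exact (hcl i).mono sdiff_subset
  · intro i j
    refine Fin.cases ?_ (fun i => ?_) i <;> refine Fin.cases ?_ (fun j => ?_) j
    · intro h; exact absurd rfl h
    · intro _; rw [hW0, hWs]; exact disjoint_of_subset_right sdiff_subset (hdQ j)
    · intro _; rw [hW0, hWs]; exact (disjoint_of_subset_right sdiff_subset (hdQ i)).symm
    · intro h; rw [hWs, hWs]
      exact disjoint_of_subset_left sdiff_subset (disjoint_of_subset_right sdiff_subset
        (hd i j (fun h' => h (by rw [h']))))
  · intro e he h1 h2 hr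
    by_cases hQe : ∃ v ∈ e, v ∈ Q
    · obtain ⟨v, hve, hvQ⟩ := hQe
      obtain ⟨u, hue, huQ⟩ : ∃ u ∈ e, u ∉ Q := by
        have := h2 0; rw [hW0, not_subset] at this; exact this
      have hcase : ∀ w ∈ e, w ∈ Q ∨ ∃ i, w ∈ P i \ ZZ := by
        intro w hw
        obtain ⟨i, hi⟩ := h1 w hw
        revert hi
        refine Fin.cases ?_ (fun i => ?_) i
        · intro h; exact Or.inl h
        · intro h; exact Or.inr ⟨i, h⟩
      obtain ⟨i, hi⟩ : ∃ i, u ∈ P i \ ZZ := by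
        rcases hcase u hue with h | h
        · exact absurd h huQ
        · exact h
      have hp : Pth k red u v e := Pth.edge hr he (fun h => huQ (h ▸ hvQ)) hue hve
      refine hZ i u (mem_sdiff.1 hi).1 v hvQ e hp ?_ ?_ he.le ?_
      · intro w hw
        rw [mem_union]
        rcases hcase w hw with h | ⟨j, h⟩
        · exact Or.inr h
        · exact Or.inl (hPX j (mem_sdiff.1 h).1)
      · exact (card_le_card inter_subset_left).trans he.le
      · rw [disjoint_left]
        intro w hw hwZ
        rcases hcase w hw with h | ⟨j, h⟩
        · exact disjoint_left.1 (hZd i) hwZ h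
        · exact (mem_sdiff.1 h).2 (mem_biUnion.2 ⟨i, mem_univ _, hwZ⟩)
    · have hcase : ∀ w ∈ e, ∃ i, w ∈ P i \ ZZ := by
        intro w hw
        obtain ⟨i, hi⟩ := h1 w hw
        revert hi
        refine Fin.cases ?_ (fun i => ?_) i
        · intro h; exact absurd ⟨w, hw, h⟩ hQe
        · intro h; exact ⟨i, h⟩
      refine hcr e he (fun w hw => ?_) (fun i hi => ?_) hr
      · obtain ⟨i, hi⟩ := hcase w hw
        exact ⟨i, (mem_sdiff.1 hi).1⟩
      · apply h2 i.succ
        rw [hWs]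
        intro w hw
        obtain ⟨j, hj⟩ := hcase w hw
        exact mem_sdiff.2 ⟨hi hw, (mem_sdiff.1 hj).2⟩

lemma match_cover (Pr : Finset V → Prop) (b : ℕ) (hb : ∀ Y, Pr Y → Y.card ≤ b) (D : ℕ) :
    (∃ Zs : Finset V, Zs.card ≤ D * b ∧ ∀ Y, Pr Y → ¬ Disjoint Y Zs) ∨
    (∃ X1 : Finset V, X1.card ≤ D * b ∧ ∀ Z : Finset V, Z.card < D → ∃ Y ⊆ X1, Pr Y ∧ Disjoint Y Z) := by
  induction D with
  | zero => right; exact ⟨∅, by simp, fun Z hZ => by omega⟩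
  | succ D ih =>
    rw [add_mul, one_mul]
    rcases ih with ⟨Zs, h1, h2⟩ | ⟨X1, h1, h2⟩
    · left; exact ⟨Zs, by omega, h2⟩
    · by_cases hY : ∃ Y, Pr Y ∧ Disjoint Y X1
      · obtain ⟨Y, hY1, hY2⟩ := hY
        right
        refine ⟨X1 ∪ Y, ?_, ?_⟩
        · have := card_union_le X1 Y
          have := hb Y hY1
          omega
        · intro Z hZ
          by_cases hd : Disjoint Y Z
          · exact ⟨Y, subset_union_right, hY1, hd⟩
          · obtain ⟨w, hwY, hwZ⟩ := not_disjoint_iff.1 hd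
            have hlt : (Z \ Y).card < Z.card := by
              apply card_lt_card
              refine ⟨sdiff_subset, fun h => ?_⟩
              exact (mem_sdiff.1 (h hwZ)).2 hwY
            obtain ⟨Y', hY', hp, hd'⟩ := h2 (Z \ Y) (by omega)
            refine ⟨Y', hY'.trans subset_union_left, hp, ?_⟩
            rw [disjoint_left]
            intro x hx hxZ
            by_cases hxY : x ∈ Y
            · exact disjoint_left.1 hY2 hxY (hY' hx)
            · exact disjoint_left.1 hd' hx (mem_sdiff.2 ⟨hxZ, hxY⟩)
      · left
        push Not at hY
        exact ⟨X1, by omega, hY⟩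

end

lemma drop_lemma {k : ℕ} (hk : 3 ≤ k) (q : ℕ) (lam : ℕ → ℕ) (dem : ℕ → ℕ → ℕ) (s : ℕ) :
    ∀ l, ∃ z p Λ Bd Δ : ℕ, ∀ (V : Type) [DecidableEq V] (red : Finset V → Prop) (ι : Type)
      [DecidableEq ι]
      (P : ι → Finset V) (J : Finset ι) (X : Finset V), J.card ≤ s → Lab k red P J X l z q →
      (∀ i ∈ J, p ≤ (P i).card) → (∀ i ∈ J, Clq k red (P i)) → (∀ i ∈ J, P i ⊆ X) →
      ∃ J' ⊆ J, ∃ X' Zs : Finset V, ∃ l' B : ℕ, X ⊆ X' ∧ l' ≤ Λ ∧ B ≤ Bd ∧ Zs.card ≤ B ∧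
        X'.card ≤ X.card + Δ ∧ Lab k red P J' X' l' (dem l' B) q ∧
        ∀ i ∈ J', ∀ j ∈ J', i ≠ j → ∀ u ∈ P i, ∀ v ∈ P j, ∀ Y, Pth k red u v Y →
          Y.card ≤ lam l' → ¬ Disjoint Y Zs := by
  induction s with
  | zero =>
    intro l
    refine ⟨dem l 0, 0, l, 0, 0, ?_⟩
    intro V _ red ι _ P J X hJ hL hp hc hX
    refine ⟨J, subset_rfl, X, ∅, l, 0, subset_rfl, le_rfl, le_rfl, by simp, by simp, hL, ?_⟩
    have : J = ∅ := by simpa using hJ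
    subst this
    simp
  | succ s ih =>
    intro l
    set b := lam l with hb
    obtain ⟨z1, p1, Λ1, Bd1, Δ1, h⟩ := ih (l + b + k)
    set D := z1 + l + 1 with hD
    set B := (s + 1) * (s + 1) * (D * b) with hB
    refine ⟨dem l B + z1, p1 + z1 + l + b + k, max l Λ1, max B Bd1, D * b + Δ1, ?_⟩
    intro V _ red ι _ P J X hJ hL hp hc hX
    have hmc := fun i j => match_cover (fun Y => ∃ u ∈ P i, ∃ v ∈ P j, Pth k red u v Y ∧ Y.card ≤ b) b
      (fun Y hY => by obtain ⟨_, _, _, _, _, h⟩ := hY; exact h) D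
    by_cases hex : ∃ i ∈ J, ∃ j ∈ J, i ≠ j ∧ ∃ X1 : Finset V, X1.card ≤ D * b ∧
        ∀ Z : Finset V, Z.card < D → ∃ Y ⊆ X1, (∃ u ∈ P i, ∃ v ∈ P j, Pth k red u v Y ∧ Y.card ≤ b) ∧ Disjoint Y Z
    · obtain ⟨i, hi, j, hj, hij, X1, hX1, hX1'⟩ := hex
      have hlab : Lab k red P (J.erase j) (X ∪ X1) (l + b + k) z1 q := by
        intro Q hQ hQc hQX
        rw [disjoint_union_right] at hQX
        obtain ⟨i0, hi0, hi0L⟩ := hL Q hQ hQc hQX.1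
        by_cases hij0 : i0 = j
        · subst hij0
          refine ⟨i, by simp [hi, hij], ?_⟩
          intro Z hZ hZd
          obtain ⟨u, hu, v, hv, Y, h1, h2, h3, h4, h5⟩ := hi0L Z (by omega) hZd
          obtain ⟨Y', hY', ⟨u', hu', v', hv', hp', hbY'⟩, hd'⟩ := hX1' (Z ∪ Y) (by
            have := card_union_le Z Y; omega)
          rw [disjoint_union_right] at hd'
          have hcc : k - 2 ≤ (P i0 \ (Z ∪ Y ∪ Y')).card := by
            have h6 := le_card_sdiff (Z ∪ Y ∪ Y') (P i0)
            have h7 := card_union_le (Z ∪ Y) Y'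
            have h8 := card_union_le Z Y
            have h9 := hp i0 hj
            omega
          obtain ⟨c, hcs, hcc⟩ := exists_subset_card_eq hcc
          have hcP : ∀ x ∈ c, x ∈ P i0 ∧ x ∉ Z ∧ x ∉ Y ∧ x ∉ Y' := by
            intro x hx
            have := hcs hx
            simp only [mem_sdiff, mem_union, not_or] at this
            tauto
          have hcY : Disjoint c Y := disjoint_left.2 fun x hx => (hcP x hx).2.2.1
          have hcY' : Disjoint c Y' := disjoint_left.2 fun x hx => (hcP x hx).2.2.2
          have huY := h1.left_mem
          have hvY' := hp'.right_mem
          have hj := hp'.join h1 hd'.2 hcY' hcY (by omega) (by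
            apply hc i0 hj
            · exact insert_subset hv' (insert_subset hu (fun x hx => (hcP x hx).1))
            · rw [card_insert_of_notMem, card_insert_of_notMem]
              · omega
              · exact fun h => disjoint_left.1 hcY h huY
              · simp only [mem_insert, not_or]
                exact ⟨fun h => disjoint_left.1 hd'.2 hvY' (h ▸ huY), fun h => disjoint_left.1 hcY' h hvY'⟩)
          have hcX : c ⊆ X := fun x hx => hX i0 (by assumption) (hcP x hx).1
          refine ⟨u', hu', v, hv, _, hj, ?_, ?_, ?_, ?_⟩
          · intro x hx
            simp only [mem_union] at hx ⊢
            rcases hx with (hx | hx) | hx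
            · exact Or.inl (Or.inr (hY' hx))
            · exact Or.inl (Or.inl (hcX hx))
            · have := h2 hx; simp only [mem_union] at this; tauto
          · refine (card_le_card ?_).trans h3
            intro x hx
            simp only [mem_union, mem_inter] at hx ⊢
            refine ⟨?_, hx.2⟩
            rcases hx.1 with (h | h) | h
            · exact absurd (hY' h) (disjoint_left.1 hQX.2 hx.2)
            · exact absurd (hcX h) (disjoint_left.1 hQX.1 hx.2)
            · exact h
          · have h7 := card_union_le (Y' ∪ c) Y
            have h8 := card_union_le Y' c
            omega
          · rw [disjoint_union_left, disjoint_union_left]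
            exact ⟨⟨hd'.1, disjoint_left.2 fun x hx => (hcP x hx).2.1⟩, h5⟩
        · exact ⟨i0, by simp [hij0, hi0], hi0L.mono subset_union_left (by omega) (by omega)⟩
      obtain ⟨J', hJ', X', Zs, l', B', h1, h2, h3, h4, h5, h6, h7⟩ := h V red ι P (J.erase j) (X ∪ X1)
        (by rw [card_erase_of_mem hj]; omega) hlab
        (fun i hi => by have := hp i (mem_of_mem_erase hi); omega) (fun i hi => hc i (mem_of_mem_erase hi))
        (fun i hi => (hX i (mem_of_mem_erase hi)).trans subset_union_left)
      refine ⟨J', hJ'.trans (erase_subset _ _), X', Zs, l', B', subset_union_left.trans h1, by omega,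
        by omega, h4, ?_, h6, h7⟩
      have := card_union_le X X1
      omega
    · have hZ : ∀ i j, ∃ Zs : Finset V, Zs.card ≤ D * b ∧ (i ∈ J → j ∈ J → i ≠ j → 
          ∀ Y, (∃ u ∈ P i, ∃ v ∈ P j, Pth k red u v Y ∧ Y.card ≤ b) → ¬ Disjoint Y Zs) := by
        intro i j
        by_cases hh : i ∈ J ∧ j ∈ J ∧ i ≠ j
        · rcases hmc i j with ⟨Zs, h1, h2⟩ | ⟨X1, h1, h2⟩
          · exact ⟨Zs, h1, fun _ _ _ => h2⟩
          · exact absurd ⟨i, hh.1, j, hh.2.1, hh.2.2, X1, h1, h2⟩ hex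
        · exact ⟨∅, by simp, fun h1 h2 h3 => absurd ⟨h1, h2, h3⟩ hh⟩
      choose ZZ hZ1 hZ2 using hZ
      refine ⟨J, subset_rfl, X, (J ×ˢ J).biUnion (fun p => ZZ p.1 p.2), l, B, subset_rfl, by omega, by omega,
        ?_, by omega, ?_, ?_⟩
      · refine (card_biUnion_le_card_mul _ _ (D * b) (fun p _ => hZ1 p.1 p.2)).trans ?_
        rw [card_product, hB]
        gcongr
      · intro Q hQ hQc hQX
        obtain ⟨i, hi, hL⟩ := hL Q hQ hQc hQX
        exact ⟨i, hi, hL.mono subset_rfl le_rfl (by omega)⟩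
      · intro i hi j hj hij u hu v hv Y hY hYc hd
        refine hZ2 i j hi hj hij Y ⟨u, hu, v, hv, hY, hYc⟩ ?_
        refine disjoint_of_subset_right ?_ hd
        exact subset_biUnion_of_mem (s := J ×ˢ J) (fun p : ι × ι => ZZ p.1 p.2) (mem_product.2 ⟨hi, hj⟩ : (i, j) ∈ J ×ˢ J)

end LC

namespace LC
open Finset

section
variable {V : Type} [DecidableEq V] {k : ℕ} {red : Finset V → Prop}

lemma path_cover_step (hk : 3 ≤ k) {m R : ℕ} (V0 : Finset V)
    (hF : ∀ S ⊆ V0, m ≤ S.card → ∃ e ⊆ S, e.card = k ∧ red e)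
    (hR : ∀ S ⊆ V0, R ≤ S.card → ∃ Q ⊆ S, Q.card = (k+1) * (k-1) + 1 ∧ Clq k red Q)
    (A : Fin m → Finset V) (hAV : ∀ a, A a ⊆ V0) (hd : ∀ a b, a ≠ b → Disjoint (A a) (A b))
    (hp : ∀ a, A a = ∅ ∨ ∃ x y, Pth k red x y (A a)) (hL : R ≤ (V0 \ univ.biUnion A).card) :
    ∃ A' : Fin m → Finset V, (∀ a, A' a ⊆ V0) ∧ (∀ a b, a ≠ b → Disjoint (A' a) (A' b)) ∧
      (∀ a, A' a = ∅ ∨ ∃ x y, Pth k red x y (A' a)) ∧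
      (univ.biUnion A).card + 1 ≤ (univ.biUnion A').card := by
  obtain ⟨Q, hQ, hQc, hQcl⟩ := hR _ sdiff_subset hL
  have hQV : Q ⊆ V0 := hQ.trans sdiff_subset
  have hQA : ∀ a, Disjoint Q (A a) := by
    intro a
    rw [disjoint_left]
    intro v hv hva
    exact (mem_sdiff.1 (hQ hv)).2 (mem_biUnion.2 ⟨a, mem_univ _, hva⟩)
  have hQp : ∃ x y, Pth k red x y Q := by
    obtain ⟨x, hx, y, hy, hxy⟩ := one_lt_card.1 (show 1 < Q.card by
      rw [hQc]
      have : 0 < (k+1) * (k-1) := Nat.mul_pos (by omega) (by omega)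
      omega)
    exact ⟨x, y, Pth.clique hk hQcl hxy hx hy hQc⟩
  have hQU : Disjoint Q (univ.biUnion A) := by
    rw [disjoint_biUnion_right]; exact fun a _ => hQA a
  have hQpos : 1 ≤ Q.card := by omega
  by_cases hemp : ∃ a, A a = ∅
  · obtain ⟨a, ha⟩ := hemp
    refine ⟨Function.update A a Q, ?_, ?_, ?_, ?_⟩
    · intro b
      by_cases hb : b = a
      · subst hb; simpa using hQV
      · simpa [hb] using hAV b
    · intro b c hbc
      by_cases hb : b = a
      · subst hb
        simpa [hbc.symm] using hQA c
      · by_cases hc : c = a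
        · subst hc
          simpa [hb] using (hQA b).symm
        · simpa [hb, hc] using hd b c hbc
    · intro b
      by_cases hb : b = a
      · subst hb; simpa using Or.inr hQp
      · simpa [hb] using hp b
    · have : Q ∪ univ.biUnion A ⊆ univ.biUnion (Function.update A a Q) := by
        intro v hv
        simp only [mem_union, mem_biUnion, mem_univ, true_and] at hv ⊢
        rcases hv with h | ⟨b, hb⟩
        · exact ⟨a, by simpa using h⟩
        · have : b ≠ a := by rintro rfl; rw [ha] at hb; simp at hb
          exact ⟨b, by simpa [this] using hb⟩
      have := card_le_card this
      rw [card_union_of_disjoint hQU] at this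
      omega
  · have hp' : ∀ a, ∃ x y, Pth k red x y (A a) := fun a => by
      rcases hp a with h | h
      · exact absurd ⟨a, h⟩ hemp
      · exact h
    choose x y hxy using hp'
    have hxA : ∀ a, x a ∈ A a := fun a => (hxy a).left_mem
    have hxu : ∀ a b, x a ∈ A b → a = b := by
      intro a b h
      by_contra hne
      exact disjoint_left.1 (hd a b hne) (hxA a) h
    have hxinj : Function.Injective x := fun a b h => hxu a b (h ▸ hxA b)
    obtain ⟨e, heS, hec, her⟩ := hF (univ.image x) (by
      intro v hv; rw [mem_image] at hv; obtain ⟨a, _, rfl⟩ := hv; exact hAV a (hxA a))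
      (by rw [card_image_of_injective _ hxinj]; simp)
    obtain ⟨u, hu, v, hv, huv⟩ := one_lt_card.1 (show 1 < e.card by omega)
    obtain ⟨a, -, rfl⟩ := mem_image.1 (heS hu)
    obtain ⟨b, -, rfl⟩ := mem_image.1 (heS hv)
    have hab : a ≠ b := fun h => huv (by rw [h])
    set c := (e.erase (x a)).erase (x b) with hc
    have hce : ∀ w ∈ c, ∃ d, d ≠ a ∧ d ≠ b ∧ w = x d ∧ x d ∈ e := by
      intro w hw
      simp only [hc, mem_erase] at hw
      obtain ⟨d, -, rfl⟩ := mem_image.1 (heS hw.2.2)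
      exact ⟨d, fun h => hw.2.1 (by rw [h]), fun h => hw.1 (by rw [h]), rfl, hw.2.2⟩
    have hins : insert (x a) (insert (x b) c) = e := by
      rw [insert_erase (by simp [hv, huv.symm]), insert_erase hu]
    have hcc : c.card + 2 = k := by
      have h3 := card_erase_of_mem hu
      have h4 := card_erase_of_mem (s := e.erase (x a)) (a := x b) (by simp [hv, huv.symm])
      rw [← hc] at h4
      omega
    choose B hBA hxB hBp hBc using fun d => (hxy d).trim hk
    let C : Fin m → Finset V := fun d => if x d ∈ e then B d else A d
    have hCA : ∀ d, C d ⊆ A d := by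
      intro d; simp only [C]; split_ifs
      · exact hBA d
      · exact subset_rfl
    have hcC : ∀ d, Disjoint c (C d) := by
      intro d
      rw [disjoint_left]
      intro w hw hwC
      obtain ⟨d', _, _, rfl, hd'⟩ := hce w hw
      have := hxu _ _ (hCA d hwC)
      subst this
      simp only [C, hd', if_true] at hwC
      exact hxB _ hwC
    have hcAa : Disjoint c (A a) := by
      rw [disjoint_left]; intro w hw hwa
      obtain ⟨d, h1, h2, rfl, _⟩ := hce w hw
      exact h1 (hxu _ _ hwa)
    have hcAb : Disjoint c (A b) := by
      rw [disjoint_left]; intro w hw hwa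
      obtain ⟨d, h1, h2, rfl, _⟩ := hce w hw
      exact h2 (hxu _ _ hwa)
    have hcV : c ⊆ V0 := by
      intro w hw
      obtain ⟨d, h1, h2, rfl, _⟩ := hce w hw
      exact hAV d (hxA d)
    have hcQ : Disjoint c Q := by
      rw [disjoint_left]; intro w hw hwQ
      obtain ⟨d, h1, h2, rfl, _⟩ := hce w hw
      exact disjoint_left.1 (hQA d) hwQ (hxA d)
    let M := A a ∪ c ∪ A b
    have hMp : Pth k red (y a) (y b) M :=
      (hxy a).symm.join (hxy b) (hd a b hab) hcAa hcAb hcc (by rwa [hins])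
    have hMC : ∀ d, d ≠ a → d ≠ b → Disjoint M (C d) := by
      intro d hda hdb
      simp only [M, disjoint_union_left]
      exact ⟨⟨disjoint_of_subset_right (hCA d) (hd a d hda.symm), hcC d⟩,
        disjoint_of_subset_right (hCA d) (hd b d hdb.symm)⟩
    have hMQ : Disjoint M Q := by
      simp only [M, disjoint_union_left]
      exact ⟨⟨(hQA a).symm, hcQ⟩, (hQA b).symm⟩
    have hQC : ∀ d, Disjoint Q (C d) := fun d => disjoint_of_subset_right (hCA d) (hQA d)
    let A' : Fin m → Finset V := fun d => if d = a then M else if d = b then Q else C d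
    have hA'a : A' a = M := by simp [A']
    have hA'b : A' b = Q := by simp [A', hab.symm]
    have hA'd : ∀ d, d ≠ a → d ≠ b → A' d = C d := by intro d h1 h2; simp [A', h1, h2]
    refine ⟨A', ?_, ?_, ?_, ?_⟩
    · intro d
      by_cases h1 : d = a
      · rw [h1, hA'a]
        exact union_subset (union_subset (hAV a) hcV) (hAV b)
      · by_cases h2 : d = b
        · rw [h2, hA'b]; exact hQV
        · rw [hA'd d h1 h2]; exact (hCA d).trans (hAV d)
    · intro d d' hdd
      by_cases h1 : d = a
      · subst h1
        rw [hA'a]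
        by_cases h2 : d' = b
        · rw [h2, hA'b]; exact hMQ
        · rw [hA'd d' hdd.symm h2]; exact hMC d' hdd.symm h2
      · by_cases h2 : d = b
        · subst h2
          rw [hA'b]
          by_cases h3 : d' = a
          · rw [h3, hA'a]; exact hMQ.symm
          · rw [hA'd d' h3 hdd.symm]; exact hQC _
        · rw [hA'd d h1 h2]
          by_cases h3 : d' = a
          · rw [h3, hA'a]; exact (hMC d h1 h2).symm
          · by_cases h4 : d' = b
            · rw [h4, hA'b]; exact (hQC d).symm
            · rw [hA'd d' h3 h4]
              exact disjoint_of_subset_left (hCA d) (disjoint_of_subset_right (hCA d') (hd d d' hdd))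
    · intro d
      by_cases h1 : d = a
      · rw [h1, hA'a]; exact Or.inr ⟨_, _, hMp⟩
      · by_cases h2 : d = b
        · rw [h2, hA'b]; exact Or.inr hQp
        · rw [hA'd d h1 h2]
          simp only [C]; split_ifs
          · exact hBp d
          · exact hp d
    · let D := univ.filter (fun d => x d ∈ c)
      have hDc : D.card ≤ k - 2 := by
        have : (D.image x).card ≤ c.card := card_le_card (by
          intro w hw; rw [mem_image] at hw; obtain ⟨d, hd, rfl⟩ := hw
          simpa [D] using hd)
        rw [card_image_of_injective _ hxinj] at this
        omega
      let Loss := D.biUnion (fun d => A d \ B d)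
      have hLoss : Loss.card ≤ (k - 2) * (k - 1) := by
        refine (card_biUnion_le_card_mul _ _ (k-1) ?_).trans (Nat.mul_le_mul_right _ hDc)
        intro d _
        rw [card_sdiff_of_subset (hBA d)]
        have := hBc d
        omega
      have hsub : Q ∪ univ.biUnion A ⊆ univ.biUnion A' ∪ Loss := by
        intro w hw
        simp only [mem_union, mem_biUnion, mem_univ, true_and] at hw ⊢
        rcases hw with h | ⟨d, h⟩
        · exact Or.inl ⟨b, by rwa [hA'b]⟩
        · by_cases h1 : d = a
          · left; refine ⟨a, ?_⟩; rw [hA'a]; subst h1; simp [M, h]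
          · by_cases h2 : d = b
            · left; refine ⟨a, ?_⟩; rw [hA'a]; subst h2; simp [M, h]
            · by_cases h3 : x d ∈ e
              · by_cases h4 : w ∈ B d
                · left; refine ⟨d, ?_⟩; rw [hA'd d h1 h2]; simp [C, h3, h4]
                · right
                  simp only [Loss, mem_biUnion, D, mem_filter, mem_univ, true_and, mem_sdiff]
                  refine ⟨d, ?_, h, h4⟩
                  simp only [hc, mem_erase]
                  exact ⟨fun h => h2 (hxinj h), fun h => h1 (hxinj h), h3⟩
              · left; refine ⟨d, ?_⟩; rw [hA'd d h1 h2]; simp [C, h3, h]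
      have h5 := card_le_card hsub
      rw [card_union_of_disjoint hQU] at h5
      have h6 := card_union_le (univ.biUnion A') Loss
      have h7 : (k - 2) * (k - 1) ≤ (k + 1) * (k - 1) := Nat.mul_le_mul_right _ (by omega)
      omega

lemma path_cover (hk : 3 ≤ k) {m R : ℕ} (V0 : Finset V)
    (hF : ∀ S ⊆ V0, m ≤ S.card → ∃ e ⊆ S, e.card = k ∧ red e)
    (hR : ∀ S ⊆ V0, R ≤ S.card → ∃ Q ⊆ S, Q.card = (k+1) * (k-1) + 1 ∧ Clq k red Q) :
    ∃ A : Fin m → Finset V, (∀ a, A a ⊆ V0) ∧ (∀ a b, a ≠ b → Disjoint (A a) (A b)) ∧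
      (∀ a, A a = ∅ ∨ ∃ x y, Pth k red x y (A a)) ∧ (V0 \ univ.biUnion A).card < R := by
  by_contra hno
  push Not at hno
  have : ∀ c, ∃ A : Fin m → Finset V, (∀ a, A a ⊆ V0) ∧ (∀ a b, a ≠ b → Disjoint (A a) (A b)) ∧
      (∀ a, A a = ∅ ∨ ∃ x y, Pth k red x y (A a)) ∧ c ≤ (univ.biUnion A).card := by
    intro c
    induction c with
    | zero => exact ⟨fun _ => ∅, by simp, by simp, by simp, by simp⟩
    | succ c ih =>
      obtain ⟨A, h1, h2, h3, h4⟩ := ih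
      obtain ⟨A', h1', h2', h3', h4'⟩ := path_cover_step hk V0 hF hR A h1 h2 h3 (hno A h1 h2 h3)
      exact ⟨A', h1', h2', h3', by omega⟩
  obtain ⟨A, h1, _, _, h4⟩ := this (V0.card + 1)
  have : (univ.biUnion A).card ≤ V0.card := card_le_card (biUnion_subset.2 fun a _ => h1 a)
  omega

end
end LC

namespace LC
open Finset

def Att {V : Type} [DecidableEq V] (k : ℕ) (red : Finset V → Prop) (P X : Finset V) (l z : ℕ)
    (y : V) (A : Finset V) : Prop :=
  ∀ Z : Finset V, Z.card ≤ z → Disjoint Z A → ∃ u ∈ P, ∃ B, Pth k red u y B ∧ B ⊆ X ∪ A ∧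
    (B ∩ X).card ≤ l ∧ Disjoint B Z

def Rdy {V : Type} [DecidableEq V] (k : ℕ) (red : Finset V → Prop) (P X : Finset V) (l z w : ℕ)
    (A : Finset V) : Prop :=
  ∃ z1 z2 A1 M A2, A = A1 ∪ M ∪ A2 ∧ Pth k red z1 z2 M ∧ Att k red P X l z z1 A1 ∧
    Att k red P X l z z2 A2 ∧ A1.card = w + 1 ∧ A2.card = w + 1 ∧ (∀ v ∈ A1, v ∈ M → v = z1) ∧
    (∀ v ∈ M, v ∈ A2 → v = z2) ∧ Disjoint A1 A2

section
variable {V : Type} [DecidableEq V] {k : ℕ} {red : Finset V → Prop}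

lemma att_of {P X A A1 Qb Q0 : Finset V} {l z q : ℕ} {y q1 : V} (hk : 3 ≤ k) (hq : k ≤ q)
    (hAX : Disjoint A X) (hQb : Qb ⊆ A) (hQcl : Clq k red Qb) (hQc : Qb.card = q + 2 * k)
    (hA1 : A1 ⊆ A) (hp : Pth k red q1 y A1) (hq1 : q1 ∈ Qb) (hA1Q : (A1 ∩ Qb).card + 1 ≤ k)
    (hQ0 : Q0 ⊆ Qb) (hQ0A : Disjoint Q0 A1) (hL : LabAt k red P X l z Q0) :
    Att k red P X l z y A := by
  intro Z hZ hZA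
  obtain ⟨u, hu, v, hv, Y, h1, h2, h3, h4, h5⟩ := hL Z hZ (disjoint_of_subset_right (hQ0.trans hQb) hZA)
  have hYQ : Y ∩ Qb ⊆ Y ∩ Q0 := by
    intro w hw
    rw [mem_inter] at hw ⊢
    refine ⟨hw.1, ?_⟩
    rcases mem_union.1 (h2 hw.1) with h | h
    · exact absurd h (disjoint_left.1 hAX (hQb hw.2))
    · exact h
  have hcc : k - 2 ≤ (Qb \ (A1 ∪ Y)).card := by
    have e : Qb \ (A1 ∪ Y) = Qb \ ((A1 ∩ Qb) ∪ (Y ∩ Qb)) := by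
      ext w; simp only [mem_sdiff, mem_union, mem_inter]; tauto
    rw [e]
    have h6 := le_card_sdiff ((A1 ∩ Qb) ∪ (Y ∩ Qb)) Qb
    have h7 := card_union_le (A1 ∩ Qb) (Y ∩ Qb)
    have h8 := card_le_card hYQ
    omega
  obtain ⟨c, hcs, hcc⟩ := exists_subset_card_eq hcc
  have hcP : ∀ x ∈ c, x ∈ Qb ∧ x ∉ A1 ∧ x ∉ Y := by
    intro x hx
    have := hcs hx
    simp only [mem_sdiff, mem_union, not_or] at this
    tauto
  have hYA1 : Disjoint Y A1 := by
    rw [disjoint_left]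
    intro w hw hw1
    rcases mem_union.1 (h2 hw) with h | h
    · exact disjoint_left.1 hAX (hA1 hw1) h
    · exact disjoint_left.1 hQ0A h hw1
  have hcY : Disjoint c Y := disjoint_left.2 fun x hx => (hcP x hx).2.2
  have hcA : Disjoint c A1 := disjoint_left.2 fun x hx => (hcP x hx).2.1
  have hvY := h1.right_mem
  have hqA := hp.left_mem
  have hcA' : c ⊆ A := fun x hx => hQb (hcP x hx).1
  have hj := h1.join hp hYA1 hcY hcA (by omega) (by
    apply hQcl
    · exact insert_subset (hQ0 hv) (insert_subset hq1 (fun x hx => (hcP x hx).1))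
    · rw [card_insert_of_notMem, card_insert_of_notMem]
      · omega
      · exact fun h => disjoint_left.1 hcA h hqA
      · simp only [mem_insert, not_or]
        exact ⟨fun h => disjoint_left.1 hYA1 hvY (h ▸ hqA), fun h => disjoint_left.1 hcY h hvY⟩)
  refine ⟨u, hu, _, hj, ?_, ?_, ?_⟩
  · intro x hx
    simp only [mem_union] at hx ⊢
    rcases hx with (hx | hx) | hx
    · rcases mem_union.1 (h2 hx) with h | h
      · exact Or.inl h
      · exact Or.inr (hQb (hQ0 h))
    · exact Or.inr (hcA' hx)
    · exact Or.inr (hA1 hx)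
  · refine (card_le_card ?_).trans h4
    intro x hx
    simp only [mem_union, mem_inter] at hx
    rcases hx.1 with (h | h) | h
    · exact h
    · exact absurd hx.2 (disjoint_left.1 hAX (hcA' h))
    · exact absurd hx.2 (disjoint_left.1 hAX (hA1 h))
  · rw [disjoint_union_left, disjoint_union_left]
    exact ⟨⟨h5, disjoint_of_subset_left hcA' hZA.symm⟩, disjoint_of_subset_left hA1 hZA.symm⟩

lemma win {ι : Type} {P : ι → Finset V} {J : Finset ι} {X A : Finset V} {l z q : ℕ} {x y : V}
    (hk : 3 ≤ k) (hq : k ≤ q) (hL : Lab k red P J X l z q) (hAX : Disjoint A X)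
    (hp : Pth k red x y A) (hcl : ∃ Q ⊆ A, Q.card = q + 2 * k ∧ Clq k red Q) :
    ∃ i ∈ J, Att k red (P i) X l z x A ∧ Att k red (P i) X l z y A := by
  obtain ⟨Qb, hQb, hQc, hQcl⟩ := hcl
  have hne : (Qb ∩ A).Nonempty := by
    rw [inter_eq_left.2 hQb]; exact card_pos.1 (by omega)
  obtain ⟨q1, hq1, A1, hA1, hp1, hc1⟩ := hp.last' hk Qb hne
  obtain ⟨q2, hq2, A2, hA2, hp2, hc2⟩ := hp.symm.last' hk Qb hne
  have hcc : q ≤ (Qb \ (A1 ∪ A2)).card := by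
    have e : Qb \ (A1 ∪ A2) = Qb \ ((A1 ∩ Qb) ∪ (A2 ∩ Qb)) := by
      ext w; simp only [mem_sdiff, mem_union, mem_inter]; tauto
    rw [e]
    have h6 := le_card_sdiff ((A1 ∩ Qb) ∪ (A2 ∩ Qb)) Qb
    have h7 := card_union_le (A1 ∩ Qb) (A2 ∩ Qb)
    omega
  obtain ⟨Q0, hQ0s, hQ0c⟩ := exists_subset_card_eq hcc
  have hQ0 : Q0 ⊆ Qb := hQ0s.trans sdiff_subset
  have hQ0d : Disjoint Q0 (A1 ∪ A2) := disjoint_of_subset_left hQ0s sdiff_disjoint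
  rw [disjoint_union_right] at hQ0d
  obtain ⟨i, hi, hLi⟩ := hL Q0 (hQcl.mono hQ0) hQ0c (disjoint_of_subset_left (hQ0.trans hQb) hAX)
  exact ⟨i, hi, att_of hk hq hAX hQb hQcl hQc hA2 hp2 hq2 hc2 hQ0 hQ0d.2 hLi,
    att_of hk hq hAX hQb hQcl hQc hA1 hp1 hq1 hc1 hQ0 hQ0d.1 hLi⟩

lemma adj {Pi Pj X Zs A B : Finset V} {l z w lam : ℕ} {y : V}
    (hi : Att k red Pi X l z y A) (hj : Att k red Pj X l z y B) (hA : A.card = w + 1)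
    (hB : B.card = w + 1) (hAB : ∀ v ∈ A, v ∈ B → v = y) (hAX : Disjoint A X) (hBX : Disjoint B X)
    (hAZ : Disjoint A Zs) (hBZ : Disjoint B Zs) (hz : Zs.card + l + w + 1 ≤ z)
    (hlam : 2 * (l + w + 1) ≤ lam)
    (hsep : ∀ u ∈ Pi, ∀ v ∈ Pj, ∀ Y, Pth k red u v Y → Y.card ≤ lam → ¬ Disjoint Y Zs) : False := by
  obtain ⟨u, hu, B1, h1, h2, h3, h4⟩ := hi Zs (by omega) hAZ.symm
  obtain ⟨v, hv, B2, g1, g2, g3, g4⟩ := hj (Zs ∪ (B1 ∩ X)) (by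
    have := card_union_le Zs (B1 ∩ X); omega) (by
    rw [disjoint_union_left]
    exact ⟨hBZ.symm, disjoint_of_subset_left inter_subset_right hBX.symm⟩)
  rw [disjoint_union_right] at g4
  have ht := h1.trans g1.symm (by
    intro a ha1 ha2
    by_cases haX : a ∈ X
    · exact absurd (mem_inter.2 ⟨ha1, haX⟩) (disjoint_left.1 g4.2 ha2)
    · have e1 := h2 ha1
      have e2 := g2 ha2
      simp only [mem_union, haX, false_or] at e1 e2
      exact hAB a e1 e2)
  refine hsep u hu v hv _ ht ?_ ?_
  · have c1 : B1.card ≤ l + (w + 1) := by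
      have : B1 ⊆ (B1 ∩ X) ∪ A := by
        intro a ha
        have := h2 ha
        simp only [mem_union, mem_inter] at this ⊢
        tauto
      have := card_le_card this
      have := card_union_le (B1 ∩ X) A
      omega
    have c2 : B2.card ≤ l + (w + 1) := by
      have : B2 ⊆ (B2 ∩ X) ∪ B := by
        intro a ha
        have := g2 ha
        simp only [mem_union, mem_inter] at this ⊢
        tauto
      have := card_le_card this
      have := card_union_le (B2 ∩ X) B
      omega
    have := card_union_le B1 B2
    omega
  · rw [disjoint_union_left]; exact ⟨h4, g4.1⟩

lemma chain_label {ι : Type} {P : ι → Finset V} {J : Finset ι} {X Zs V0 : Finset V}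
    {l z q w lam d : ℕ}
    (hk : 3 ≤ k) (hq : k ≤ q) (hL : Lab k red P J X l z q) (hVX : Disjoint V0 X)
    (hVZ : Disjoint V0 Zs) (hw : w = d * (k - 1)) (hw0 : 0 < w)
    (hcl : ∀ S ⊆ V0, w + 1 ≤ S.card → ∃ Q ⊆ S, Q.card = q + 2 * k ∧ Clq k red Q)
    (hz : Zs.card + l + w + 1 ≤ z) (hlam : 2 * (l + w + 1) ≤ lam)
    (hsep : ∀ i ∈ J, ∀ j ∈ J, i ≠ j → ∀ u ∈ P i, ∀ v ∈ P j, ∀ Y, Pth k red u v Y →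
          Y.card ≤ lam → ¬ Disjoint Y Zs) (T : ℕ) :
    ∀ (x y : V) (A : Finset V), A ⊆ V0 → Pth k red x y A → A.card = (T + 1) * w + 1 →
    ∃ i ∈ J, (∃ z1 A1 M A2, Pth k red z1 y M ∧ A = A1 ∪ M ∧ (∀ v ∈ A1, v ∈ M → v = z1) ∧
        A1.card = w + 1 ∧ M.card = T * w + 1 ∧
        Att k red (P i) X l z z1 A1 ∧ A2 ⊆ A ∧ A2.card = w + 1 ∧ Att k red (P i) X l z y A2) ∧
      ∀ s, 3 ≤ s → s ≤ T + 1 → ∃ A' ⊆ A, A'.card = s * w + 1 ∧ Rdy k red (P i) X l z w A' := by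
  induction T with
  | zero =>
    intro x y A hA hp hc
    simp only [zero_add, one_mul] at hc
    obtain ⟨i, hi, h1, h2⟩ := win hk hq hL (disjoint_of_subset_left hA hVX) hp (hcl A hA hc.ge)
    refine ⟨i, hi, ⟨y, A, {y}, A, Pth.single y, ?_, by simp, hc, by simp, h2, subset_rfl, hc, h2⟩, ?_⟩
    · rw [eq_comm, union_eq_left]; simpa using hp.right_mem
    · intro s h1 h2; omega
  | succ T ih =>
    intro x y A hA hp hc
    have e1 : (T + 1 + 1) * w = (T + 1) * w + w := by ring
    have e2 : (T + 1) * d * (k - 1) = (T + 1) * w := by rw [hw]; ring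
    obtain ⟨a, B, A2, hB, hA2, hBA, hint, hBc⟩ := hp.split hk ((T + 1) * d) (by rw [e2]; omega)
    rw [e2] at hBc
    have hBs : B ⊆ A := hBA ▸ subset_union_left
    have hA2s : A2 ⊆ A := hBA ▸ subset_union_right
    have haB := hB.right_mem
    have haA2 := hA2.left_mem
    have hA2c : A2.card = w + 1 := by
      have h1 := card_union_add_card_inter B A2
      have h2 : B ∩ A2 = {a} := by
        ext v; simp only [mem_inter, mem_singleton]
        exact ⟨fun h => hint v h.1 h.2, fun h => h ▸ ⟨haB, haA2⟩⟩
      rw [h2, hBA, card_singleton] at h1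
      omega
    obtain ⟨i, hi, ⟨z1, A1, M, A2', g1, g2, g3, g4, g5, g6, g7, g8, g9⟩, hrd⟩ := ih x a B (hBs.trans hA) hB hBc
    obtain ⟨j, hj, f1, f2⟩ := win hk hq hL (disjoint_of_subset_left (hA2s.trans hA) hVX) hA2
      (hcl A2 (hA2s.trans hA) hA2c.ge)
    have hij : i = j := by
      by_contra hne
      exact adj g9 f1 g8 hA2c (fun v hv hv' => hint v (g7 hv) hv')
        (disjoint_of_subset_left ((g7.trans hBs).trans hA) hVX)
        (disjoint_of_subset_left (hA2s.trans hA) hVX)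
        (disjoint_of_subset_left ((g7.trans hBs).trans hA) hVZ)
        (disjoint_of_subset_left (hA2s.trans hA) hVZ) hz hlam (hsep i hi j hj hne)
    subst hij
    have hA1B : A1 ⊆ B := g2 ▸ subset_union_left
    have hMB : M ⊆ B := g2 ▸ subset_union_right
    have hMp := g1.trans hA2 (fun v hv hv' => hint v (hMB hv) hv')
    refine ⟨i, hi, ⟨z1, A1, M ∪ A2, A2, hMp, ?_, ?_, g4, ?_, g6, hA2s, hA2c, f2⟩, ?_⟩
    · rw [← union_assoc, ← g2, hBA]
    · intro v hv hv'
      rcases mem_union.1 hv' with h | h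
      · exact g3 v hv h
      · have := hint v (hA1B hv) h
        subst this
        exact g3 _ hv g1.right_mem
    · have h1 := card_union_add_card_inter M A2
      have h2 : M ∩ A2 = {a} := by
        ext v; simp only [mem_inter, mem_singleton]
        exact ⟨fun h => hint v (hMB h.1) h.2, fun h => h ▸ ⟨g1.right_mem, haA2⟩⟩
      rw [h2, card_singleton] at h1
      have e3 : (T + 1) * w = T * w + w := by ring
      omega
    · intro s hs1 hs2
      rcases Nat.lt_or_ge s (T + 2) with hs | hs
      · obtain ⟨A', hA', h⟩ := hrd s hs1 (by omega)
        exact ⟨A', hA'.trans hBs, h⟩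
      · have hsT : s = T + 1 + 1 := by omega
        subst hsT
        refine ⟨A, subset_rfl, hc, z1, a, A1, M, A2, ?_, g1, g6, f1, g4, hA2c, g3, 
          fun v hv hv' => hint v (hMB hv) hv', ?_⟩
        · rw [← g2, hBA]
        · rw [disjoint_left]
          intro v hv hv'
          have h1 := hint v (hA1B hv) hv'
          subst h1
          have h2 := g3 _ hv g1.right_mem
          subst h2
          have := g1.eq_single
          rw [this, card_singleton] at g5
          have : 0 < T * w := Nat.mul_pos (by omega) hw0
          omega

lemma ear {P X A Z : Finset V} {l z w : ℕ} (h : Rdy k red P X l z w A) (hAX : Disjoint A X)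
    (hZ : Z.card + l ≤ z) (hZA : Disjoint Z A) :
    ∃ u ∈ P, ∃ v ∈ P, ∃ E, Pth k red u v E ∧ E ⊆ X ∪ A ∧ (E ∩ X).card ≤ 2 * l ∧
      (A \ E).card ≤ 2 * (w + 1) ∧ Disjoint E Z := by
  obtain ⟨z1, z2, A1, M, A2, rfl, hM, a1, a2, c1, c2, i1, i2, hd⟩ := h
  rw [disjoint_union_left, disjoint_union_left] at hAX
  rw [disjoint_union_right, disjoint_union_right] at hZA
  obtain ⟨⟨hX1, hXM⟩, hX2⟩ := hAX
  obtain ⟨⟨hZ1, hZM⟩, hZ2⟩ := hZA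
  obtain ⟨u, hu, B1, h1, h2, h3, h4⟩ := a1 Z (by omega) hZ1
  obtain ⟨v, hv, B2, g1, g2, g3, g4⟩ := a2 (Z ∪ (B1 ∩ X)) (by
    have := card_union_le Z (B1 ∩ X); omega) (by
    rw [disjoint_union_left]
    exact ⟨hZ2, disjoint_of_subset_left inter_subset_right hX2.symm⟩)
  rw [disjoint_union_right] at g4
  have p1 := h1.trans hM (by
    intro a ha hb
    rcases mem_union.1 (h2 ha) with h | h
    · exact absurd h (disjoint_left.1 hXM hb)
    · exact i1 a h hb)
  have p2 := p1.trans g1.symm (by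
    intro a ha hb
    rcases mem_union.1 (g2 hb) with h | h
    · rcases mem_union.1 ha with h' | h'
      · exact absurd (mem_inter.2 ⟨h', h⟩) (disjoint_left.1 g4.2 hb)
      · exact absurd h (disjoint_left.1 hXM h')
    · rcases mem_union.1 ha with h' | h'
      · rcases mem_union.1 (h2 h') with h'' | h''
        · exact absurd h'' (disjoint_left.1 hX2 h)
        · exact absurd h (disjoint_left.1 hd h'')
      · exact i2 a h' h)
  refine ⟨u, hu, v, hv, _, p2, ?_, ?_, ?_, ?_⟩
  · intro a ha
    simp only [mem_union] at ha ⊢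
    rcases ha with (ha | ha) | ha
    · have := h2 ha; simp only [mem_union] at this; tauto
    · tauto
    · have := g2 ha; simp only [mem_union] at this; tauto
  · have : (B1 ∪ M ∪ B2) ∩ X ⊆ (B1 ∩ X) ∪ (B2 ∩ X) := by
      intro a ha
      simp only [mem_union, mem_inter] at ha ⊢
      rcases ha with ⟨(ha | ha) | ha, hx⟩
      · tauto
      · exact absurd hx (disjoint_left.1 hXM ha)
      · tauto
    have := card_le_card this
    have := card_union_le (B1 ∩ X) (B2 ∩ X)
    omega
  · have : (A1 ∪ M ∪ A2) \ (B1 ∪ M ∪ B2) ⊆ A1 ∪ A2 := by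
      intro a ha
      simp only [mem_union, mem_sdiff] at ha ⊢
      tauto
    have := card_le_card this
    have := card_union_le A1 A2
    omega
  · rw [disjoint_union_left, disjoint_union_left]
    exact ⟨⟨h4, hZM.symm⟩, g4.1⟩

lemma ears {ι κ : Type} [DecidableEq κ] {P : ι → Finset V} {X V0 : Finset V} {l z w m : ℕ} (lbl : κ → ι)
    (A : κ → Finset V) (hVX : Disjoint V0 X) (hA : ∀ a, A a ⊆ V0) (S : Finset κ) (hS : S.card ≤ m)
    (hd : ∀ a ∈ S, ∀ b ∈ S, a ≠ b → Disjoint (A a) (A b)) (hz : m * (2 * l) + l ≤ z)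
    (hr : ∀ a ∈ S, Rdy k red (P (lbl a)) X l z w (A a)) :
    ∃ E : κ → Finset V, (∀ a ∈ S, (∃ u ∈ P (lbl a), ∃ v ∈ P (lbl a), Pth k red u v (E a)) ∧
      E a ⊆ X ∪ A a ∧ (E a ∩ X).card ≤ 2 * l ∧ (A a \ E a).card ≤ 2 * (w + 1)) ∧
      ∀ a ∈ S, ∀ b ∈ S, a ≠ b → Disjoint (E a) (E b) := by
  induction S using Finset.induction_on with
  | empty => exact ⟨fun _ => ∅, by simp, by simp⟩
  | insert a S ha ih =>
    rw [card_insert_of_notMem ha] at hS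
    obtain ⟨E, h1, h2⟩ := ih (by omega) (fun b hb c hc => hd b (by simp [hb]) c (by simp [hc]))
      (fun b hb => hr b (by simp [hb]))
    have hcard : (S.biUnion (fun b => E b ∩ X)).card ≤ m * (2 * l) := by
      refine (card_biUnion_le_card_mul _ _ (2 * l) (fun b hb => (h1 b hb).2.2.1)).trans ?_
      exact Nat.mul_le_mul_right _ (by omega)
    have hAX : ∀ b, Disjoint (A b) X := fun b => disjoint_of_subset_left (hA b) hVX
    obtain ⟨u, hu, v, hv, Ea, e1, e2, e3, e4, e5⟩ := ear (Z := S.biUnion (fun b => E b ∩ X))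
      (hr a (by simp)) (hAX a) (by omega) (by
        rw [disjoint_biUnion_left]
        intro b hb
        exact disjoint_of_subset_left inter_subset_right (hAX a).symm)
    have hne : ∀ b ∈ S, b ≠ a := fun b hb h => ha (h ▸ hb)
    have key : ∀ b ∈ S, Disjoint Ea (E b) := by
      intro b hb
      rw [disjoint_left]
      intro x hx hxb
      by_cases hxX : x ∈ X
      · exact disjoint_left.1 e5 hx (mem_biUnion.2 ⟨b, hb, mem_inter.2 ⟨hxb, hxX⟩⟩)
      · have g1 := e2 hx
        have g2 := (h1 b hb).2.1 hxb
        simp only [mem_union, hxX, false_or] at g1 g2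
        exact disjoint_left.1 (hd a (by simp) b (by simp [hb]) (hne b hb).symm) g1 g2
    refine ⟨Function.update E a Ea, ?_, ?_⟩
    · intro b hb
      by_cases hba : b = a
      · subst hba
        simp only [Function.update_self]
        exact ⟨⟨u, hu, v, hv, e1⟩, e2, e3, e4⟩
      · simp only [Function.update_of_ne hba]
        exact h1 b (by simpa [hba] using hb)
    · intro b hb c hc hbc
      by_cases hba : b = a
      · subst hba
        simp only [Function.update_self, Function.update_of_ne hbc.symm]
        exact key c (by simpa [hbc.symm] using hc)
      · by_cases hca : c = a
        · subst hca
          simp only [Function.update_self, Function.update_of_ne hba]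
          exact (key b (by simpa [hba] using hb)).symm
        · simp only [Function.update_of_ne hba, Function.update_of_ne hca]
          exact h2 b (by simpa [hba] using hb) c (by simpa [hca] using hc) hbc

lemma trunc {κ : Type} [DecidableEq κ] (S : Finset κ) (s : κ → ℕ) (w : ℕ) (hw : 0 < w)
    (hs : ∀ a ∈ S, 3 ≤ s a) (t : ℕ) (ht : t ≤ ∑ a ∈ S, (s a * w + 1)) :
    ∃ S' ⊆ S, ∃ s' : κ → ℕ, (∀ a ∈ S', 3 ≤ s' a ∧ s' a ≤ s a) ∧ ∑ a ∈ S', (s' a * w + 1) ≤ t ∧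
      t ≤ ∑ a ∈ S', (s' a * w + 1) + (3 * w + 1) := by
  induction S using Finset.induction_on with
  | empty => exact ⟨∅, by simp, s, by simp, by simp, by simp at ht ⊢; omega⟩
  | insert a S ha ih =>
    by_cases hle : t ≤ ∑ a ∈ S, (s a * w + 1)
    · obtain ⟨S', h1, s', h2⟩ := ih (fun b hb => hs b (by simp [hb])) hle
      exact ⟨S', h1.trans (subset_insert _ _), s', h2⟩
    · rw [sum_insert ha] at ht
      set Sg := ∑ a ∈ S, (s a * w + 1) with hSg
      by_cases hrem : t - Sg < 3 * w + 1
      · refine ⟨S, subset_insert _ _, s, fun b hb => ⟨hs b (by simp [hb]), le_rfl⟩, by omega, by omega⟩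
      · set r := (t - Sg - 1) / w with hr
        have h1 : r * w ≤ t - Sg - 1 := Nat.div_mul_le_self _ _
        have h2 : t - Sg - 1 < (r + 1) * w := by
          rw [mul_comm]; exact Nat.lt_mul_div_succ _ hw
        have h2' : (r + 1) * w = r * w + w := by ring
        have h3 : 3 ≤ r := (Nat.le_div_iff_mul_le hw).2 (by omega)
        have h4 : r ≤ s a := by
          by_contra hlt
          have : (s a + 1) * w ≤ r * w := Nat.mul_le_mul_right _ (by omega)
          rw [add_mul] at this
          omega
        have hsum : ∑ b ∈ S, (Function.update s a r b * w + 1) = Sg := by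
          apply sum_congr rfl
          intro b hb
          have hba : b ≠ a := fun h => ha (h ▸ hb)
          rw [Function.update_of_ne hba]
        refine ⟨insert a S, subset_rfl, Function.update s a r, ?_, ?_, ?_⟩
        · intro b hb
          by_cases hba : b = a
          · subst hba; simp [h3, h4]
          · simp [Function.update_of_ne hba, hs b hb]
        · rw [sum_insert ha, hsum, Function.update_self]; omega
        · rw [sum_insert ha, hsum, Function.update_self]; omega

end
end LC

namespace LC
open Finset

section
variable {V : Type} [DecidableEq V] {k : ℕ} {red : Finset V → Prop}

lemma lab_paths {ι : Type} [Nonempty ι] {P : ι → Finset V} {J : Finset ι} {X Zs V0 : Finset V}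
    {l z q w lam d m R : ℕ}
    (hk : 3 ≤ k) (hq : k ≤ q) (hL : Lab k red P J X l z q) (hVX : Disjoint V0 X)
    (hVZ : Disjoint V0 Zs) (hw : w = d * (k - 1)) (hw0 : 0 < w)
    (hcl : ∀ S ⊆ V0, w + 1 ≤ S.card → ∃ Q ⊆ S, Q.card = q + 2 * k ∧ Clq k red Q)
    (hz : Zs.card + l + w + 1 ≤ z) (hlam : 2 * (l + w + 1) ≤ lam)
    (hsep : ∀ i ∈ J, ∀ j ∈ J, i ≠ j → ∀ u ∈ P i, ∀ v ∈ P j, ∀ Y, Pth k red u v Y →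
          Y.card ≤ lam → ¬ Disjoint Y Zs)
    (hF : ∀ S ⊆ V0, m ≤ S.card → ∃ e ⊆ S, e.card = k ∧ red e)
    (hR : ∀ S ⊆ V0, R ≤ S.card → ∃ Q ⊆ S, Q.card = (k+1) * (k-1) + 1 ∧ Clq k red Q) :
    ∃ (S : Finset (Fin m)) (lbl : Fin m → ι) (s : Fin m → ℕ) (B : Fin m → Finset V),
      (∀ a, B a ⊆ V0) ∧ (∀ a b, a ≠ b → Disjoint (B a) (B b)) ∧
      (∀ a ∈ S, lbl a ∈ J ∧ 3 ≤ s a ∧ (B a).card = s a * w + 1 ∧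
        ∀ s', 3 ≤ s' → s' ≤ s a → ∃ A' ⊆ B a, A'.card = s' * w + 1 ∧
          Rdy k red (P (lbl a)) X l z w A') ∧
      (V0 \ S.biUnion B).card ≤ R + m * (3 * w + 1) := by
  obtain ⟨A, hAV, hAd, hAp, hAR⟩ := path_cover hk V0 hF hR
  have key : ∀ a, ∃ (Ba : Finset V) (i : ι) (s : ℕ), Ba ⊆ A a ∧ (A a \ Ba).card ≤ 3 * w + 1 ∧
      (Ba = ∅ ∨ (i ∈ J ∧ 3 ≤ s ∧ Ba.card = s * w + 1 ∧ ∀ s', 3 ≤ s' → s' ≤ s → ∃ A' ⊆ Ba,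
        A'.card = s' * w + 1 ∧ Rdy k red (P i) X l z w A')) := by
    intro a
    by_cases hlt : (A a).card < 3 * w + 1
    · exact ⟨∅, Classical.arbitrary ι, 0, by simp, by simpa using hlt.le, Or.inl rfl⟩
    rcases hAp a with h0 | ⟨x, y, hp⟩
    · rw [h0] at hlt; simp at hlt
    set T := ((A a).card - 1) / w with hT
    have h1 : T * w ≤ (A a).card - 1 := Nat.div_mul_le_self _ _
    have h2 : (A a).card - 1 < (T + 1) * w := by
      rw [mul_comm]; exact Nat.lt_mul_div_succ _ hw0
    have h2' : (T + 1) * w = T * w + w := by ring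
    have h3 : 3 ≤ T := (Nat.le_div_iff_mul_le hw0).2 (by omega)
    have e : T * d * (k - 1) = T * w := by rw [hw]; ring
    obtain ⟨y', A1, A2, hA1, -, hun, -, hc⟩ := hp.split hk (T * d) (by rw [e]; omega)
    rw [e] at hc
    have hA1A : A1 ⊆ A a := by rw [← hun]; exact subset_union_left
    clear_value T
    obtain ⟨T', rfl⟩ : ∃ T', T = T' + 1 := ⟨T - 1, by omega⟩
    obtain ⟨i, hi, -, h⟩ := chain_label hk hq hL hVX hVZ hw hw0 hcl hz hlam hsep T' x y' A1
      (hA1A.trans (hAV a)) hA1 hc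
    refine ⟨A1, i, T' + 1, hA1A, ?_, Or.inr ⟨hi, h3, hc, h⟩⟩
    rw [card_sdiff_of_subset hA1A, hc]; omega
  choose B lbl s hBA hBc hB using key
  refine ⟨univ.filter (fun a => B a ≠ ∅), lbl, s, B, fun a => (hBA a).trans (hAV a),
    fun a b hab => disjoint_of_subset_left (hBA a) (disjoint_of_subset_right (hBA b) (hAd a b hab)), ?_, ?_⟩
  · intro a ha
    rcases hB a with h | h
    · simp [h] at ha
    · exact h
  · have : (V0 \ (univ.filter (fun a => B a ≠ ∅)).biUnion B) ⊆
        (V0 \ univ.biUnion A) ∪ univ.biUnion (fun a => A a \ B a) := by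
      intro v hv
      simp only [mem_sdiff, mem_biUnion, mem_filter, mem_univ, true_and, mem_union, not_exists,
        not_and] at hv ⊢
      by_cases hex : ∃ a, v ∈ A a
      · obtain ⟨a, ha⟩ := hex
        right
        refine ⟨a, ha, fun hvB => hv.2 a ?_ hvB⟩
        exact ne_empty_of_mem hvB
      · left; exact ⟨hv.1, fun a ha => hex ⟨a, ha⟩⟩
    refine (card_le_card this).trans ((card_union_le _ _).trans ?_)
    have h2 : (univ.biUnion (fun a => A a \ B a)).card ≤ m * (3 * w + 1) := by
      refine (card_biUnion_le_card_mul _ _ (3 * w + 1) (fun a _ => hBc a)).trans ?_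
      simp
    omega

lemma ear_card_upper {κ : Type} [DecidableEq κ] {S : Finset κ} {A E : κ → Finset V} {X : Finset V} {l : ℕ}
    (h1 : ∀ a ∈ S, E a ⊆ X ∪ A a) (h2 : ∀ a ∈ S, (E a ∩ X).card ≤ 2 * l) :
    (S.biUnion E).card ≤ ∑ a ∈ S, (A a).card + S.card * (2 * l) := by
  refine card_biUnion_le.trans ?_
  rw [← smul_eq_mul, ← sum_const, ← sum_add_distrib]
  refine sum_le_sum (fun a ha => ?_)
  have : E a ⊆ (E a ∩ X) ∪ A a := by
    intro v hv
    have := h1 a ha hv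
    simp only [mem_union, mem_inter] at this ⊢
    tauto
  have := (card_le_card this).trans (card_union_le _ _)
  have := h2 a ha
  omega

lemma ear_card_lower {κ : Type} [DecidableEq κ] {S : Finset κ} {A E : κ → Finset V} {w : ℕ}
    (hd : ∀ a ∈ S, ∀ b ∈ S, a ≠ b → Disjoint (E a) (E b))
    (h2 : ∀ a ∈ S, (A a \ E a).card ≤ 2 * (w + 1)) :
    ∑ a ∈ S, (A a).card ≤ (S.biUnion E).card + S.card * (2 * (w + 1)) := by
  rw [card_biUnion hd, ← smul_eq_mul, ← sum_const, ← sum_add_distrib]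
  refine sum_le_sum (fun a ha => ?_)
  have : A a ⊆ (A a \ E a) ∪ E a := by
    intro v hv
    simp only [mem_union, mem_sdiff]
    tauto
  have := (card_le_card this).trans (card_union_le _ _)
  have := h2 a ha
  omega

lemma ear_inter {κ : Type} [DecidableEq κ] {S : Finset κ} {A E : κ → Finset V} {X W : Finset V} {l : ℕ}
    (h1 : ∀ a ∈ S, E a ⊆ X ∪ A a) (h2 : ∀ a ∈ S, (E a ∩ X).card ≤ 2 * l)
    (hW : ∀ a ∈ S, Disjoint (A a) W) :
    ((S.biUnion E) ∩ W).card ≤ S.card * (2 * l) := by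
  have : (S.biUnion E) ∩ W ⊆ S.biUnion (fun a => E a ∩ X) := by
    intro v hv
    simp only [mem_inter, mem_biUnion] at hv ⊢
    obtain ⟨⟨a, ha, hva⟩, hvW⟩ := hv
    refine ⟨a, ha, hva, ?_⟩
    rcases mem_union.1 (h1 a ha hva) with h | h
    · exact h
    · exact absurd hvW (disjoint_left.1 (hW a ha) h)
  exact (card_le_card this).trans (card_biUnion_le_card_mul _ _ _ h2)

lemma too_long {ι : Type} {P : ι → Finset V} {X V0 W : Finset V}
    {l z w m n c2 : ℕ} {i : ι} (hk : 3 ≤ k) (hn : (k - 1) ∣ n) (hn2 : 2 * (k - 1) ≤ n)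
    (hVX : Disjoint V0 X) (hw0 : 0 < w) (hWV : Disjoint V0 W) (hPW : P i ⊆ W) (hW : Clq k red W)
    (hz : m * (2 * l) + l ≤ z)
    (S : Finset (Fin m)) (s : Fin m → ℕ) (B : Fin m → Finset V)
    (hBV : ∀ a, B a ⊆ V0) (hd : ∀ a b, a ≠ b → Disjoint (B a) (B b))
    (hS : ∀ a ∈ S, 3 ≤ s a ∧ (B a).card = s a * w + 1 ∧
        ∀ s', 3 ≤ s' → s' ≤ s a → ∃ A' ⊆ B a, A'.card = s' * w + 1 ∧
          Rdy k red (P i) X l z w A')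
    (hWc : (m * (2 * l) + m * (k - 2) + c2) + (3 * w + 1) + m * (2 * (w + 1)) + m * (2 * l) ≤ W.card)
    (hlong : n ≤ ∑ a ∈ S, (B a).card + (m * (2 * l) + m * (k - 2) + c2)) : HasCyc k red n := by
  set c1 := m * (2 * l) + m * (k - 2) + c2 with hc1
  have hsum : ∑ a ∈ S, (B a).card = ∑ a ∈ S, (s a * w + 1) :=
    sum_congr rfl (fun a ha => (hS a ha).2.1)
  obtain ⟨S', hS', s', hs', ht1, ht2⟩ := trunc S s w hw0 (fun a ha => (hS a ha).1) (n - c1) (by omega)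
  have hch : ∀ a, ∃ A' : Finset V, A' ⊆ B a ∧ (a ∈ S' → A'.card = s' a * w + 1 ∧
      Rdy k red (P i) X l z w A') := by
    intro a
    by_cases ha : a ∈ S'
    · obtain ⟨A', h1, h2⟩ := (hS a (hS' ha)).2.2 (s' a) (hs' a ha).1 (hs' a ha).2
      exact ⟨A', h1, fun _ => h2⟩
    · exact ⟨∅, by simp, fun h => absurd h ha⟩
  choose A' hA'B hA' using hch
  have hScard : S'.card ≤ m := by simpa using card_le_univ S'
  obtain ⟨E, hE, hEd⟩ := ears (k := k) (red := red) (P := P) (X := X) (V0 := V0) (l := l) (z := z) (w := w) (m := m)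
    (fun _ => i) A' hVX (fun a => (hA'B a).trans (hBV a)) S' hScard
    (fun a _ b _ hab => disjoint_of_subset_left (hA'B a) (disjoint_of_subset_right (hA'B b) (hd a b hab)))
    hz (fun a ha => (hA' a ha).2)
  have hsum' : ∑ a ∈ S', (A' a).card = ∑ a ∈ S', (s' a * w + 1) :=
    sum_congr rfl (fun a ha => (hA' a ha).1)
  have u := ear_card_upper (fun a ha => (hE a ha).2.1) (fun a ha => (hE a ha).2.2.1)
  have lo := ear_card_lower hEd (fun a ha => (hE a ha).2.2.2)
  have hi := ear_inter (W := W) (fun a ha => (hE a ha).2.1) (fun a ha => (hE a ha).2.2.1)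
    (fun a ha => disjoint_of_subset_left ((hA'B a).trans (hBV a)) hWV)
  have m1 := Nat.mul_le_mul_right (2 * l) hScard
  have m2 := Nat.mul_le_mul_right (2 * (w + 1)) hScard
  have m3 := Nat.mul_le_mul_right (k - 2) hScard
  have hes := ES.biUnion (k := k) (red := red) (W := W) E S' (fun a ha => by
    obtain ⟨⟨u, hu, v, hv, h⟩, -⟩ := hE a ha
    exact ⟨u, hPW hu, v, hPW hv, h⟩) hEd
  by_cases hnc : n ≤ c1
  · refine ES.cyc (H := W) (g := 0) hk hW ES.nil subset_rfl (by simp) hn (by simp) ?_ hn2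
    simp; omega
  refine hes.cyc (H := W \ S'.biUnion E) hk hW sdiff_subset sdiff_disjoint hn (by omega) ?_ hn2
  have : W.card ≤ (W \ S'.biUnion E).card + (S'.biUnion E ∩ W).card := by
    rw [card_sdiff, ]
    omega
  omega

end
end LC

namespace LC
open Finset

def Apx {V : Type} [DecidableEq V] [Fintype V] (k : ℕ) (red : Finset V → Prop) (n m K1 c2 : ℕ) {r : ℕ}
    (W E : Fin r → Finset V) : Prop :=
  (∃ g : Fin r → ℕ, ∀ i, ES k red (W i) (g i) (E i) ∧ g i ≤ m ∧ (E i).card + g i * (k - 2) + c2 ≤ n) ∧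
  (∀ i j, i ≠ j → Disjoint (E i) (E j)) ∧
  (∀ i, (univ.biUnion E ∩ W i).card ≤ K1) ∧
  (univ \ univ.biUnion (fun i => W i ∪ E i)).card ≤ K1

lemma approx {k : ℕ} (hk : 3 ≤ k) (m ρ r q : ℕ) (hr1 : 1 ≤ r) (hrρ : r ≤ ρ) (hq : k ≤ q) :
    ∃ K1 : ℕ, ∀ c2 : ℕ, ∃ L n1 : ℕ, ∀ (V : Type) [Fintype V] [DecidableEq V] (red : Finset V → Prop) (n : ℕ),
      n1 ≤ n → (k - 1) ∣ n → ¬ HasCyc k red n →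
      (∀ S : Finset V, m ≤ S.card → ∃ e ⊆ S, e.card = k ∧ red e) →
      ρ * (n - 1) + 1 ≤ Fintype.card V → ∀ W : Fin r → Finset V, (∀ i, L ≤ (W i).card) →
      (∀ i, Clq k red (W i)) → (∀ i j, i ≠ j → Disjoint (W i) (W j)) →
      (∀ e : Finset V, e.card = k → (∀ v ∈ e, ∃ i, v ∈ W i) → (∀ i, ¬ e ⊆ W i) → ¬ red e) →
      ¬ BX k red (r + 1) q → r = ρ ∧ ∃ E : Fin r → Finset V, Apx k red n m K1 c2 W E := by
  obtain ⟨R, hR⟩ := ramsey_ex k ((k+1) * (k-1) + 1) m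
  obtain ⟨R2, hR2⟩ := ramsey_ex k (q + 2 * k) m
  set d := R2 + 1 with hdd
  set w := d * (k - 1) with hw
  have hw0 : 0 < w := Nat.mul_pos (by omega) (by omega)
  have hwR2 : R2 ≤ w := by
    have : d * 1 ≤ d * (k - 1) := Nat.mul_le_mul_left _ (by omega)
    omega
  obtain ⟨z, p, Λ, Bd, Δ, hdrop⟩ := drop_lemma hk q (fun l => 2 * (l + w + 1))
    (fun l B => B + l + w + 1 + (m * (2 * l) + l)) r k
  set K1 := (r * (q + r * z + p) + Δ) + Bd + (R + m * (3 * w + 1)) + m * (2 * (w + 1)) + m * (2 * Λ)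
    with hK1
  refine ⟨K1, fun c2 => ?_⟩
  set L := (q + r * z + p) + (m * (2 * Λ) + m * (k - 2) + c2) + (3 * w + 1) + m * (2 * (w + 1)) + m * (2 * Λ) with hLdef
  refine ⟨L, K1 + 2 * (k - 1) + 1, ?_⟩
  intro V _ _ red n hn hdvd hnc hF hV W hWL hWcl hWd hWcr hB
  have : Nonempty (Fin r) := ⟨⟨0, hr1⟩⟩
  have hPex : ∀ i, ∃ P ⊆ W i, P.card = q + r * z + p := fun i =>
    exists_subset_card_eq (by have := hWL i; omega)
  choose P hPW hPc using hPex
  have hlab := lab_base (k := k) (red := red) (z := z) (q := q) P (fun i => by rw [hPc]; omega)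
    (fun i => (hWcl i).mono (hPW i))
    (fun i j hij => disjoint_of_subset_left (hPW i) (disjoint_of_subset_right (hPW j) (hWd i j hij)))
    (fun e he hv hne hre => hWcr e he (fun v hv' => (hv v hv').imp (fun i hi => hPW i hi))
      (by
        intro i hi
        refine hne i (fun v hve => ?_)
        obtain ⟨j, hj⟩ := hv v hve
        by_cases hij : j = i
        · exact hij ▸ hj
        · exact absurd (hi hve) (disjoint_left.1 (hWd j i hij) (hPW j hj))) hre) hB
  obtain ⟨J, -, X, Zs, l, B, hXX, hlΛ, hBB, hZB, hXc, hL, hsep⟩ := hdrop V red (Fin r) P univ (univ.biUnion P)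
    (by simp) hlab (fun i _ => by rw [hPc]; omega) (fun i _ => (hWcl i).mono (hPW i))
    (fun i _ => subset_biUnion_of_mem P (mem_univ i))
  have hX0 : (univ.biUnion P).card ≤ r * (q + r * z + p) := by
    refine (card_biUnion_le_card_mul _ _ _ (fun i _ => (hPc i).le)).trans ?_
    simp
  set V0 := univ \ (X ∪ Zs ∪ J.biUnion W) with hV0
  have hVX : Disjoint V0 X := by
    rw [disjoint_left]; intro v hv hvx; simp [hV0, hvx] at hv
  have hVZ : Disjoint V0 Zs := by
    rw [disjoint_left]; intro v hv hvx; simp [hV0, hvx] at hv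
  have hVW : ∀ i ∈ J, Disjoint V0 (W i) := by
    intro i hi
    rw [disjoint_left]; intro v hv hvx
    simp only [hV0, mem_sdiff, mem_union, mem_biUnion, not_or] at hv
    exact hv.2.2 ⟨i, hi, hvx⟩
  have hnoblue : ∀ M : Finset V, M.card = m → ¬ ∀ e ⊆ M, e.card = k → ¬ red e := by
    intro M hM hno
    obtain ⟨e, h1, h2, h3⟩ := hF M hM.ge
    exact hno e h1 h2 h3
  obtain ⟨S, lbl, s, Bp, hBV, hBd, hS, hleft⟩ := lab_paths (m := m) (R := R) (d := d) (w := w) hk hq hL hVX hVZ hw hw0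
    (fun S _ hS => by
      rcases hR2 V red S (by omega) with h | ⟨M, _, hM, h⟩
      · exact h
      · exact absurd h (hnoblue M hM)) (by omega) le_rfl hsep (fun S _ hS => hF S hS)
    (fun S _ hS => by
      rcases hR V red S hS with h | ⟨M, _, hM, h⟩
      · exact h
      · exact absurd h (hnoblue M hM))
  have hΛ : m * (2 * l) ≤ m * (2 * Λ) := Nat.mul_le_mul_left _ (by omega)
  have hSc : S.card ≤ m := by simpa using card_le_univ S
  have short : ∀ i ∈ J, ∑ a ∈ S.filter (fun a => lbl a = i), (Bp a).card +
      (m * (2 * l) + m * (k - 2) + c2) < n := by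
    intro i hi
    by_contra hlong
    refine hnc (too_long (i := i) (z := B + l + w + 1 + (m * (2 * l) + l)) (P := P) (X := X) (V0 := V0) (W := W i) (l := l) (w := w) (c2 := c2)
      hk hdvd (by omega) hVX hw0 (hVW i hi) (hPW i) (hWcl i) (by omega)
      (S.filter (fun a => lbl a = i)) s Bp hBV hBd ?_ (by have := hWL i; omega) (by omega))
    intro a ha
    rw [mem_filter] at ha
    obtain ⟨_, h1, h2, h3⟩ := hS a ha.1
    rw [ha.2] at h3
    exact ⟨h1, h2, h3⟩
  obtain ⟨E, hE, hEd⟩ := ears (k := k) (red := red) (P := P) (X := X) (V0 := V0) (l := l)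
    (z := B + l + w + 1 + (m * (2 * l) + l)) (w := w) (m := m)
    lbl Bp hVX hBV S hSc (fun a _ b _ hab => hBd a b hab) (by omega)
    (fun a ha => by
      obtain ⟨_, h1, h2, h3⟩ := hS a ha
      obtain ⟨A', hA', hc, h⟩ := h3 (s a) h1 le_rfl
      rwa [eq_of_subset_of_card_le hA' (by omega)] at h)
  let Si : Fin r → Finset (Fin m) := fun i => S.filter (fun a => lbl a = i)
  have hSi : ∀ i, Si i ⊆ S := fun i => filter_subset _ _
  let EE : Fin r → Finset V := fun i => (Si i).biUnion E
  have hSic : ∀ i, (Si i).card ≤ m := fun i => (card_le_card (hSi i)).trans hSc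
  have hES : ∀ i, ES k red (W i) (Si i).card (EE i) := fun i => ES.biUnion E (Si i) (fun a ha => by
    obtain ⟨⟨u, hu, v, hv, h⟩, -⟩ := hE a (hSi i ha)
    have hl : lbl a = i := (mem_filter.1 ha).2
    rw [hl] at hu hv
    exact ⟨u, hPW i hu, v, hPW i hv, h⟩) (fun a ha b hb => hEd a (hSi i ha) b (hSi i hb))
  have hEEc : ∀ i ∈ J, (EE i).card + (Si i).card * (k - 2) + c2 ≤ n := by
    intro i hi
    have u := ear_card_upper (S := Si i) (fun a ha => (hE a (hSi i ha)).2.1) (fun a ha => (hE a (hSi i ha)).2.2.1)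
    have sh := short i hi
    have m1 := Nat.mul_le_mul_right (2 * l) (hSic i)
    have m3 := Nat.mul_le_mul_right (k - 2) (hSic i)
    change ∑ a ∈ Si i, (Bp a).card + _ < n at sh
    change (EE i).card ≤ _ at u
    omega
  have hEEd : ∀ i j, i ≠ j → Disjoint (EE i) (EE j) := by
    intro i j hij
    simp only [EE, disjoint_biUnion_left, disjoint_biUnion_right]
    intro a ha b hb
    refine hEd b (hSi i hb) a (hSi j ha) ?_ |> fun h => h
    rintro rfl
    exact hij ((mem_filter.1 hb).2.symm.trans (mem_filter.1 ha).2)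
  have hEES : univ.biUnion EE = S.biUnion E := by
    ext v
    simp only [EE, Si, mem_biUnion, mem_filter, mem_univ, true_and]
    constructor
    · rintro ⟨i, a, ⟨ha, _⟩, hv⟩; exact ⟨a, ha, hv⟩
    · rintro ⟨a, ha, hv⟩; exact ⟨lbl a, a, ⟨ha, rfl⟩, hv⟩
  have hint : ∀ i ∈ J, (univ.biUnion EE ∩ W i).card ≤ K1 := by
    intro i hi
    rw [hEES]
    have := ear_inter (W := W i) (fun a ha => (hE a ha).2.1) (fun a ha => (hE a ha).2.2.1)
      (fun a ha => disjoint_of_subset_left (hBV a) (hVW i hi))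
    have m1 := Nat.mul_le_mul_right (2 * l) hSc
    omega
  have hU : (univ \ J.biUnion (fun i => W i ∪ EE i)).card ≤ K1 := by
    have hsub : (univ \ J.biUnion (fun i => W i ∪ EE i)) ⊆
        X ∪ Zs ∪ (V0 \ S.biUnion Bp) ∪ S.biUnion (fun a => Bp a \ E a) := by
      intro v hv
      simp only [mem_sdiff, mem_univ, true_and, mem_biUnion, mem_union, not_exists, not_and, not_or] at hv
      simp only [mem_union]
      by_contra hno
      push Not at hno
      obtain ⟨⟨⟨h1, h2⟩, h3⟩, h4⟩ := hno
      have hvV : v ∈ V0 := by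
        simp only [hV0, mem_sdiff, mem_univ, true_and, mem_union, mem_biUnion, not_or]
        exact ⟨⟨h1, h2⟩, fun ⟨i, hi, hvi⟩ => (hv i hi).1 hvi⟩
      simp only [mem_sdiff, not_and, not_not] at h3
      obtain ⟨a, ha, hva⟩ := mem_biUnion.1 (h3 hvV)
      simp only [mem_biUnion, mem_sdiff, not_exists, not_and, not_not] at h4
      have := h4 a ha hva
      exact (hv (lbl a) (hS a ha).1).2 (mem_biUnion.2 ⟨a, mem_filter.2 ⟨ha, rfl⟩, this⟩)
    have c1 := card_le_card hsub
    have c2 := card_union_le (X ∪ Zs ∪ (V0 \ S.biUnion Bp)) (S.biUnion (fun a => Bp a \ E a))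
    have c3 := card_union_le (X ∪ Zs) (V0 \ S.biUnion Bp)
    have c4 := card_union_le X Zs
    have c5 := card_biUnion_le_card_mul S (fun a => Bp a \ E a) _ (fun a ha => (hE a ha).2.2.2)
    have m2 := Nat.mul_le_mul_right (2 * (w + 1)) hSc
    omega
  have hn1 : ∀ i ∈ J, (W i \ univ.biUnion EE ∪ EE i).card ≤ n - 1 := by
    intro i hi
    by_contra hlt
    have hEi : EE i ⊆ univ.biUnion EE := subset_biUnion_of_mem EE (mem_univ i)
    have hdis : Disjoint (W i \ univ.biUnion EE) (EE i) :=
      disjoint_of_subset_right hEi sdiff_disjoint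
    rw [card_union_of_disjoint hdis] at hlt
    have := hEEc i hi
    exact hnc ((hES i).cyc hk (hWcl i) sdiff_subset hdis hdvd (by omega) (by omega) (by omega))
  have hJ : ρ ≤ J.card := by
    by_contra hlt
    have hcov : (univ : Finset V) ⊆ (univ \ J.biUnion (fun i => W i ∪ EE i)) ∪
        J.biUnion (fun i => W i \ univ.biUnion EE ∪ EE i) := by
      intro v _
      simp only [mem_union, mem_sdiff, mem_univ, true_and]
      by_contra hno
      push Not at hno
      obtain ⟨h1, h2⟩ := hno
      simp only [mem_biUnion, mem_union, mem_sdiff, not_exists, not_and, not_or] at h1 h2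
      obtain ⟨i, hi, hvi⟩ := h1
      rcases hvi with hvi | hvi
      · have := (h2 i hi).1 hvi
        push Not at this
        obtain ⟨j, -, hj⟩ := this
        have hj' : v ∈ S.biUnion E := hEES ▸ mem_biUnion.2 ⟨j, mem_univ _, hj⟩
        obtain ⟨a, ha⟩ := mem_biUnion.1 hj'
        exact (h2 (lbl a) (hS a ha.1).1).2 (mem_biUnion.2 ⟨a, mem_filter.2 ⟨ha.1, rfl⟩, ha.2⟩)
      · exact (h2 i hi).2 hvi
    have c1 := card_le_card hcov
    have c2 := card_union_le (univ \ J.biUnion (fun i => W i ∪ EE i)) (J.biUnion (fun i => W i \ univ.biUnion EE ∪ EE i))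
    have c3 := card_biUnion_le_card_mul J (fun i => W i \ univ.biUnion EE ∪ EE i) _ hn1
    rw [card_univ] at c1
    have c4 : (J.card + 1) * (n - 1) ≤ ρ * (n - 1) := Nat.mul_le_mul_right _ (by omega)
    rw [add_mul, one_mul] at c4
    omega
  have hJr : J.card ≤ r := by simpa using card_le_univ J
  have hJu : J = univ := by
    apply eq_univ_of_card; simp; omega
  subst hJu
  exact ⟨by omega, EE, ⟨fun i => (Si i).card, fun i => ⟨hES i, hSic i, hEEc i (mem_univ i)⟩⟩, hEEd,
    fun i => hint i (mem_univ i), hU⟩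

end LC

namespace LC
open Finset

def Con {V : Type} [DecidableEq V] (k : ℕ) (red : Finset V → Prop) {r : ℕ} (W : Fin r → Finset V) (z : ℕ)
    (i j : Fin r) (S : Finset V) : Prop :=
  ∀ Z : Finset V, Z.card ≤ z → ∃ u ∈ W i, ∃ v ∈ W j, ∃ T ⊆ univ.biUnion W, Disjoint T Z ∧
    T.card ≤ k ∧ Pth k red u v (S ∪ T)

inductive AS {V : Type} [DecidableEq V] (k : ℕ) (red : Finset V → Prop) {r : ℕ} (W : Fin r → Finset V)
    (z : ℕ) (i : Fin r) : ℕ → Finset V → Prop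
  | nil : AS k red W z i 0 ∅
  | cons {t : ℕ} {R S : Finset V} : AS k red W z i t R → Con k red W z i i S → Disjoint S R →
      S.Nonempty → AS k red W z i (t + 1) (R ∪ S)

section
variable {V : Type} [DecidableEq V] {k : ℕ} {red : Finset V → Prop}

lemma ES.union {W E D : Finset V} {g g' : ℕ} (h : ES k red W g E) (h' : ES k red W g' D)
    (hd : Disjoint D E) : ES k red W (g + g') (E ∪ D) := by
  induction h' with
  | nil => simpa using h
  | cons h1 hp hu hv hdd ih =>
    rw [disjoint_union_left] at hd
    rw [← union_assoc, ← add_assoc]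
    exact ES.cons (ih hd.1) hp hu hv (disjoint_union_right.2 ⟨hd.2, hdd⟩)

lemma gain {W E EU D : Finset V} {g g' n c2 : ℕ} (hk : 3 ≤ k) (hdvd : (k - 1) ∣ n) (hn2 : 2 * (k - 1) ≤ n)
    (hnc : ¬ HasCyc k red n) (hW : Clq k red W) (h : ES k red W g E) (hEU : E ⊆ EU)
    (hg : E.card + g * (k - 2) + c2 ≤ n) (hD : ES k red W g' D) (hDE : Disjoint D EU)
    (hDc : D.card + g' * (k - 2) ≤ c2) : (W \ EU).card + E.card + (D \ W).card ≤ n - 1 := by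
  by_contra hlt
  have hDE' : Disjoint D E := disjoint_of_subset_right hEU hDE
  refine hnc ((h.union hD hDE').cyc (H := W \ (EU ∪ D)) hk hW sdiff_subset ?_ hdvd ?_ ?_ hn2)
  · exact disjoint_of_subset_right (union_subset_union_left hEU) sdiff_disjoint
  · rw [card_union_of_disjoint hDE'.symm, add_mul]; omega
  · rw [card_union_of_disjoint hDE'.symm]
    have h1 : (W \ EU).card ≤ (W \ (EU ∪ D)).card + (D ∩ W).card := by
      refine (card_le_card ?_).trans (card_union_le _ _)
      intro v hv
      simp only [mem_sdiff, mem_union, mem_inter] at hv ⊢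
      tauto
    have h2 := card_sdiff_add_card_inter D W
    omega

lemma AS.le_card {r : ℕ} {W : Fin r → Finset V} {z : ℕ} {i : Fin r} {t : ℕ} {R : Finset V}
    (h : AS k red W z i t R) : t ≤ R.card := by
  induction h with
  | nil => simp
  | cons h hc hd hne ih =>
    rw [card_union_of_disjoint hd.symm]
    have := hne.card_pos
    omega

lemma AS.real {r : ℕ} {W : Fin r → Finset V} {z : ℕ} {i : Fin r} {t : ℕ} {R : Finset V}
    (h : AS k red W z i t R) (Z : Finset V) (hZ : Z.card + t * k ≤ z)
    (hR : Disjoint R (univ.biUnion W)) :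
    ∃ D, ES k red (W i) t D ∧ R ⊆ D ∧ D ⊆ R ∪ (univ.biUnion W \ Z) ∧ D.card ≤ R.card + t * k := by
  induction h with
  | nil => exact ⟨∅, ES.nil, by simp, by simp, by simp⟩
  | @cons t R S h hc hd hne ih =>
    rw [disjoint_union_left] at hR
    rw [add_mul, one_mul] at hZ
    obtain ⟨D, h1, h2, h3, h4⟩ := ih (by omega) hR.1
    have hZc : (Z ∪ (D \ R)).card ≤ z := by
      have := card_union_le Z (D \ R)
      rw [card_sdiff_of_subset h2] at this
      omega
    obtain ⟨u, hu, v, hv, T, hT, hTZ, hTk, hp⟩ := hc _ hZc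
    rw [disjoint_union_right] at hTZ
    have hTD : Disjoint T D := by
      rw [disjoint_left]
      intro x hx hxD
      by_cases hxR : x ∈ R
      · exact disjoint_left.1 hR.1 hxR (hT hx)
      · exact disjoint_left.1 hTZ.2 hx (mem_sdiff.2 ⟨hxD, hxR⟩)
    have hSD : Disjoint S D := by
      rw [disjoint_left]
      intro x hx hxD
      rcases mem_union.1 (h3 hxD) with h | h
      · exact disjoint_left.1 hd hx h
      · exact disjoint_left.1 hR.2 hx (mem_sdiff.1 h).1
    refine ⟨D ∪ (S ∪ T), ES.cons h1 hp hu hv (disjoint_union_left.2 ⟨hSD, hTD⟩), ?_, ?_, ?_⟩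
    · exact union_subset_union h2 subset_union_left
    · intro x hx
      simp only [mem_union] at hx
      rcases hx with hx | hx | hx
      · have := h3 hx
        simp only [mem_union] at this ⊢
        tauto
      · simp [hx]
      · simp only [mem_union, mem_sdiff]
        exact Or.inr ⟨hT hx, disjoint_left.1 hTZ.1 hx⟩
    · rw [card_union_of_disjoint hd.symm]
      have a1 := card_union_le D (S ∪ T)
      have a2 := card_union_le S T
      rw [add_mul, one_mul]
      omega

lemma excursion {r : ℕ} {W : Fin r → Finset V} {z N : ℕ} {i j : Fin r} {S S' Z : Finset V} (hk : 3 ≤ k)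
    (hN : 1 ≤ N) (hij : i ≠ j) (hWd : ∀ i j, i ≠ j → Disjoint (W i) (W j))
    (hcl : Clq k red (W j)) (h : Con k red W z i j S)
    (h' : Con k red W z i j S') (hSS : Disjoint S S') (hS : Disjoint S (univ.biUnion W))
    (hS' : Disjoint S' (univ.biUnion W)) (hSc : S.card ≤ 2 * k) (hSc' : S'.card ≤ 2 * k)
    (hZ : Z.card + k ≤ z) (hW : Z.card + 6 * k + (N * (k - 1) + 1) ≤ (W j).card) :
    ∃ D, ES k red (W i) 1 D ∧ D ⊆ S ∪ S' ∪ (univ.biUnion W \ Z) ∧ D.card ≤ 6 * k + (N * (k - 1) + 1) ∧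
      N ≤ (D \ W i).card := by
  obtain ⟨u, hu, v, hv, T, hT, hTZ, hTk, hp⟩ := h Z (by omega)
  obtain ⟨u', hu', v', hv', T', hT', hTZ', hTk', hp'⟩ := h' (Z ∪ T) (by
    have := card_union_le Z T; omega)
  rw [disjoint_union_right] at hTZ'
  set M := univ.biUnion W with hM
  have hjM : W j ⊆ M := subset_biUnion_of_mem W (mem_univ j)
  have hYY : Disjoint (S ∪ T) (S' ∪ T') := by
    simp only [disjoint_union_left, disjoint_union_right]
    exact ⟨⟨hSS, (disjoint_of_subset_right hT hS').symm⟩, disjoint_of_subset_right hT' hS, hTZ'.2.symm⟩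
  have hNk : 2 ≤ N * (k - 1) := Nat.mul_le_mul hN (by omega : 2 ≤ k - 1)
  have hbase : N * (k - 1) - 1 ≤ (W j \ (Z ∪ ((S ∪ T) ∪ (S' ∪ T')))).card := by
    have a1 := le_card_sdiff (Z ∪ ((S ∪ T) ∪ (S' ∪ T'))) (W j)
    have a2 := card_union_le Z ((S ∪ T) ∪ (S' ∪ T'))
    have a3 := card_union_le (S ∪ T) (S' ∪ T')
    have a4 := card_union_le S T
    have a5 := card_union_le S' T'
    omega
  obtain ⟨B, hB, hBc⟩ := exists_subset_card_eq hbase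
  have hvY := hp.right_mem
  have hvY' := hp'.right_mem
  have hvv : v ≠ v' := fun h => disjoint_left.1 hYY hvY (h ▸ hvY')
  have hBnot : ∀ x ∈ B, x ∈ W j ∧ x ∉ Z ∧ x ∉ S ∪ T ∧ x ∉ S' ∪ T' := by
    intro x hx
    have := hB hx
    simp only [mem_sdiff, mem_union, not_or] at this ⊢
    tauto
  have hv'B : v' ∉ B := fun h => (hBnot _ h).2.2.2 hvY'
  have hvB : v ∉ insert v' B := by
    simp only [mem_insert, not_or]
    exact ⟨hvv, fun h => (hBnot _ h).2.2.1 hvY⟩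
  set Q := insert v (insert v' B) with hQ
  have hQc : Q.card = N * (k - 1) + 1 := by
    rw [hQ, card_insert_of_notMem hvB, card_insert_of_notMem hv'B]; omega
  have hQW : Q ⊆ W j := by
    intro x hx
    simp only [hQ, mem_insert] at hx
    rcases hx with rfl | rfl | hx
    · exact hv
    · exact hv'
    · exact (hBnot _ hx).1
  have hpQ : Pth k red v v' Q := Pth.clique hk (hcl.mono hQW) hvv (by simp [hQ]) (by simp [hQ]) hQc
  have h1 : Pth k red u v' ((S ∪ T) ∪ Q) := hp.trans hpQ (by
    intro x hx hxQ
    simp only [hQ, mem_insert] at hxQ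
    rcases hxQ with h | h | h
    · exact h
    · exact absurd hvY' (h ▸ disjoint_left.1 hYY hx)
    · exact absurd hx (hBnot _ h).2.2.1)
  have h2 : Pth k red u u' (((S ∪ T) ∪ Q) ∪ (S' ∪ T')) := h1.trans hp'.symm (by
    intro x hx hxQ
    rcases mem_union.1 hx with hx | hx
    · exact absurd hxQ (disjoint_left.1 hYY hx)
    simp only [hQ, mem_insert] at hx
    rcases hx with h | h | h
    · exact absurd hxQ (h ▸ disjoint_left.1 hYY hvY)
    · exact h
    · exact absurd hxQ (hBnot _ h).2.2.2)
  refine ⟨((S ∪ T) ∪ Q) ∪ (S' ∪ T'), ?_, ?_, ?_, ?_⟩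
  · simpa using ES.cons ES.nil h2 hu hu' (by simp)
  · have hvZ : ∀ x ∈ S ∪ T, x ∈ M → x ∉ Z := by
      intro x hx hxM
      rcases mem_union.1 hx with h | h
      · exact absurd hxM (disjoint_left.1 hS h)
      · exact disjoint_left.1 hTZ h
    have hvZ' : ∀ x ∈ S' ∪ T', x ∈ M → x ∉ Z := by
      intro x hx hxM
      rcases mem_union.1 hx with h | h
      · exact absurd hxM (disjoint_left.1 hS' h)
      · exact disjoint_left.1 hTZ'.1 h
    intro x hx
    simp only [mem_union, mem_sdiff] at hx ⊢
    rcases hx with ((hx | hx) | hx) | (hx | hx)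
    · tauto
    · exact Or.inr ⟨hT hx, disjoint_left.1 hTZ hx⟩
    · refine Or.inr ⟨hjM (hQW hx), ?_⟩
      have hxM := hjM (hQW hx)
      simp only [hQ, mem_insert] at hx
      rcases hx with rfl | rfl | hx
      · exact hvZ _ hvY hxM
      · exact hvZ' _ hvY' hxM
      · exact (hBnot _ hx).2.1
    · tauto
    · exact Or.inr ⟨hT' hx, disjoint_left.1 hTZ'.1 hx⟩
  · have a2 := card_union_le ((S ∪ T) ∪ Q) (S' ∪ T')
    have a3 := card_union_le (S ∪ T) Q
    have a4 := card_union_le S T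
    have a5 := card_union_le S' T'
    omega
  · have : Q ⊆ (((S ∪ T) ∪ Q) ∪ (S' ∪ T')) \ W i := by
      intro x hx
      simp only [mem_sdiff, mem_union]
      exact ⟨by tauto, fun h => disjoint_left.1 (hWd i j hij) h (hQW hx)⟩
    have a := card_le_card this
    have : N * 1 ≤ N * (k - 1) := Nat.mul_le_mul_left _ (by omega)
    omega

lemma split_abs {r : ℕ} (W : Fin r → Finset V) (z : ℕ) : ∀ (c : ℕ) (U : Finset V), U.card = c →
    ∃ (R : Fin r → Finset V) (t : Fin r → ℕ) (U' : Finset V), U ⊆ U' ∪ univ.biUnion R ∧ U' ⊆ U ∧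
      (∀ i, R i ⊆ U) ∧ (∀ i, AS k red W z i (t i) (R i)) ∧
      ∀ i, ∀ S ⊆ U', S.Nonempty → ¬ Con k red W z i i S := by
  intro c
  induction c using Nat.strong_induction_on with
  | _ c ih =>
    intro U hU
    by_cases hex : ∃ i, ∃ S ⊆ U, S.Nonempty ∧ Con k red W z i i S
    · obtain ⟨i, S, hS, hne, hc⟩ := hex
      obtain ⟨R, t, U', h1, h2, h3, h4, h5⟩ := ih (U \ S).card (by
        rw [card_sdiff_of_subset hS]
        have := hne.card_pos
        have := card_le_card hS
        omega) (U \ S) rfl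
      refine ⟨Function.update R i (R i ∪ S), Function.update t i (t i + 1), U', ?_, h2.trans sdiff_subset, ?_, ?_, h5⟩
      · intro x hx
        simp only [mem_union, mem_biUnion, mem_univ, true_and]
        by_cases hxS : x ∈ S
        · right; exact ⟨i, by simp [hxS]⟩
        · have := h1 (mem_sdiff.2 ⟨hx, hxS⟩)
          simp only [mem_union, mem_biUnion, mem_univ, true_and] at this
          rcases this with h | ⟨j, hj⟩
          · exact Or.inl h
          · right
            refine ⟨j, ?_⟩
            by_cases hji : j = i
            · subst hji; simp [hj]
            · rwa [Function.update_of_ne hji]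
      · intro j
        by_cases hji : j = i
        · subst hji; rw [Function.update_self]
          exact union_subset ((h3 j).trans sdiff_subset) hS
        · rw [Function.update_of_ne hji]; exact (h3 j).trans sdiff_subset
      · intro j
        by_cases hji : j = i
        · subst hji; rw [Function.update_self, Function.update_self]
          exact AS.cons (h4 j) hc (disjoint_of_subset_right (h3 j) disjoint_sdiff) hne
        · rw [Function.update_of_ne hji, Function.update_of_ne hji]; exact h4 j
    · push Not at hex
      exact ⟨fun _ => ∅, fun _ => 0, U, by simp, subset_rfl, by simp, fun _ => AS.nil,
        fun i S hS hne => hex i S hS hne⟩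

end
end LC

namespace LC
open Finset

section
variable {V : Type} [DecidableEq V] {k : ℕ} {red : Finset V → Prop}

/-- Blocking step. -/
lemma block {r : ℕ} (hk : 3 ≤ k) {W : Fin r → Finset V} {z m : ℕ} {I : Finset V}
    (hWd : ∀ i j, i ≠ j → Disjoint (W i) (W j))
    (hcr : ∀ e : Finset V, e.card = k → (∀ v ∈ e, ∃ i, v ∈ W i) → (∀ i, ¬ e ⊆ W i) → ¬ red e)
    (hIW : Disjoint I (univ.biUnion W))
    (hA : ∀ i j, ∀ S ⊆ I, S.Nonempty → S.card ≤ 2 * k → ¬ Con k red W z i j S)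
    (hF : ∀ S ⊆ I, S.card = k - 1 → ¬ ∃ i, ∀ Z : Finset V, Z.card ≤ z + 1 → ∃ v ∈ W i, v ∉ Z ∧ red (insert v S))
    (hL : ∀ i, m + 2 ^ I.card * (r * (r * z + (z + 1))) ≤ (W i).card) :
    ∃ W' : Fin r → Finset V, (∀ i j, i ≠ j → Disjoint (W' i) (W' j)) ∧ (∀ i, Disjoint I (W' i)) ∧
      (∀ i, m ≤ (W' i).card) ∧ ∀ e : Finset V, e.card = k → (∀ v ∈ e, v ∈ I ∨ ∃ i, v ∈ W' i) → ¬ e ⊆ I →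
        (∀ i, ¬ e ⊆ W' i) → ¬ red e := by
  have h1 : ∀ (S : Finset V) (i j : Fin r), ∃ Z : Finset V, Z.card ≤ z ∧ (S ⊆ I → S.Nonempty → S.card ≤ 2 * k →
      ∀ u ∈ W i, ∀ v ∈ W j, ∀ T ⊆ univ.biUnion W, Disjoint T Z → T.card ≤ k → ¬ Pth k red u v (S ∪ T)) := by
    intro S i j
    by_cases h : S ⊆ I ∧ S.Nonempty ∧ S.card ≤ 2 * k
    · have := hA i j S h.1 h.2.1 h.2.2
      unfold Con at this
      push Not at this
      obtain ⟨Z, hZ, h⟩ := this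
      exact ⟨Z, hZ, fun _ _ _ => h⟩
    · exact ⟨∅, by simp, fun a b c => absurd ⟨a, b, c⟩ h⟩
  have h2 : ∀ (S : Finset V) (i : Fin r), ∃ Z : Finset V, Z.card ≤ z + 1 ∧ (S ⊆ I → S.card = k - 1 →
      ∀ v ∈ W i, v ∉ Z → ¬ red (insert v S)) := by
    intro S i
    by_cases h : S ⊆ I ∧ S.card = k - 1
    · have := hF S h.1 h.2
      push Not at this
      obtain ⟨Z, hZ, h⟩ := this i
      exact ⟨Z, hZ, fun _ _ => h⟩
    · exact ⟨∅, by simp, fun a b => absurd ⟨a, b⟩ h⟩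
  choose Z1 hZ1c hZ1 using h1
  choose Z2 hZ2c hZ2 using h2
  set ZZ := I.powerset.biUnion (fun S => univ.biUnion (fun i => univ.biUnion (fun j => Z1 S i j) ∪ Z2 S i)) with hZZ
  have hZZc : ZZ.card ≤ 2 ^ I.card * (r * (r * z + (z + 1))) := by
    rw [← card_powerset]
    refine card_biUnion_le_card_mul _ _ _ (fun S _ => ?_)
    refine (card_biUnion_le_card_mul _ _ (r * z + (z + 1)) (fun i _ => ?_)).trans (by simp)
    refine (card_union_le _ _).trans (Nat.add_le_add ?_ (hZ2c S i))
    exact (card_biUnion_le_card_mul _ _ z (fun j _ => hZ1c S i j)).trans (by simp)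
  have hWM : ∀ i, W i ⊆ univ.biUnion W := fun i => subset_biUnion_of_mem W (mem_univ i)
  refine ⟨fun i => W i \ ZZ, ?_, ?_, ?_, ?_⟩
  · intro i j hij
    exact disjoint_of_subset_left sdiff_subset (disjoint_of_subset_right sdiff_subset (hWd i j hij))
  · intro i
    exact disjoint_of_subset_right (sdiff_subset.trans (hWM i)) hIW
  · intro i
    change m ≤ (W i \ ZZ).card
    have := le_card_sdiff ZZ (W i)
    have := hL i
    omega
  · intro e hek hev heI heW hred
    have hmemS : ∀ S ⊆ I, ∀ i j, Z1 S i j ⊆ ZZ ∧ Z2 S i ⊆ ZZ := by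
      intro S hS i j
      constructor
      · intro x hx
        simp only [hZZ, mem_biUnion, mem_powerset, mem_univ, true_and, mem_union]
        exact ⟨S, hS, i, Or.inl ⟨j, hx⟩⟩
      · intro x hx
        simp only [hZZ, mem_biUnion, mem_powerset, mem_univ, true_and, mem_union]
        exact ⟨S, hS, i, Or.inr hx⟩
    set S := e ∩ I with hS
    set T := e \ I with hT
    have hSI : S ⊆ I := inter_subset_right
    have hST : S ∪ T = e := by
      ext x; simp only [hS, hT, mem_union, mem_inter, mem_sdiff]; tauto
    have hTe : T ⊆ e := sdiff_subset
    have hcST : S.card + T.card = k := by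
      rw [← hek, add_comm]; exact card_sdiff_add_card_inter e I
    have hTW : ∀ v ∈ T, (∃ i, v ∈ W i) ∧ v ∉ ZZ := by
      intro v hv
      have hv' := mem_sdiff.1 hv
      rcases hev v hv'.1 with h | ⟨i, h⟩
      · exact absurd h hv'.2
      · exact ⟨⟨i, (mem_sdiff.1 h).1⟩, (mem_sdiff.1 h).2⟩
    have hTM : T ⊆ univ.biUnion W := by
      intro v hv
      obtain ⟨i, hi⟩ := (hTW v hv).1
      exact hWM i hi
    have hTZ : ∀ Z ⊆ ZZ, Disjoint T Z := by
      intro Z hZ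
      rw [disjoint_left]
      exact fun v hv hvZ => (hTW v hv).2 (hZ hvZ)
    rcases S.eq_empty_or_nonempty with h0 | hne
    · rw [h0, empty_union] at hST
      refine hcr e hek (fun v hv => (hTW v (hST ▸ hv)).1) (fun i hi => heW i (fun v hv => ?_)) hred
      exact mem_sdiff.2 ⟨hi hv, (hTW v (hST ▸ hv)).2⟩
    have hTne : T.Nonempty := by
      rw [nonempty_iff_ne_empty]
      intro h
      exact heI (sdiff_eq_empty_iff_subset.1 h)
    by_cases hT1 : T.card = 1
    · obtain ⟨v, hv⟩ := card_eq_one.1 hT1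
      obtain ⟨⟨i, hi⟩, hvZ⟩ := hTW v (by simp [hv])
      refine hZ2 S i hSI (by omega) v hi (fun h => hvZ ((hmemS S hSI i i).2 h)) ?_
      rw [← hST, hv, union_comm] at hred
      exact hred
    · have hT2 : 1 < T.card := by have := hTne.card_pos; omega
      obtain ⟨u, hu, v, hv, huv⟩ := one_lt_card.1 hT2
      obtain ⟨⟨i, hi⟩, -⟩ := hTW u hu
      obtain ⟨⟨j, hj⟩, -⟩ := hTW v hv
      refine hZ1 S i j hSI hne (by omega) u hi v hj T hTM (hTZ _ (hmemS S hSI i j).1) (by omega) ?_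
      rw [hST]
      exact Pth.edge hred hek huv (hTe hu) (hTe hv)

lemma no_loose {r : ℕ} (hk : 3 ≤ k) {W : Fin r → Finset V} {z : ℕ} {e f : Finset V} {i j : Fin r}
    (he : e.card = k - 1) (hf : f.card = k - 1) (hef : (e ∩ f).card = 1)
    (hWe : Disjoint e (univ.biUnion W)) (hWf : Disjoint f (univ.biUnion W))
    (h1 : ∀ Z : Finset V, Z.card ≤ z + 1 → ∃ v ∈ W i, v ∉ Z ∧ red (insert v e))
    (h2 : ∀ Z : Finset V, Z.card ≤ z + 1 → ∃ v ∈ W j, v ∉ Z ∧ red (insert v f)) :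
    Con k red W z i j (e ∪ f) := by
  intro Z hZ
  have hWM : ∀ i, W i ⊆ univ.biUnion W := fun i => subset_biUnion_of_mem W (mem_univ i)
  obtain ⟨x, hx⟩ := card_eq_one.1 hef
  have hxm : x ∈ e ∩ f := by simp [hx]
  rw [mem_inter] at hxm
  obtain ⟨u, hu, huZ, hur⟩ := h1 Z (by omega)
  obtain ⟨v, hv, hvZ, hvr⟩ := h2 (insert u Z) (by have := card_insert_le u Z; omega)
  have hue : u ∉ e := fun h => disjoint_left.1 hWe h (hWM i hu)
  have huf : u ∉ f := fun h => disjoint_left.1 hWf h (hWM i hu)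
  have hve : v ∉ e := fun h => disjoint_left.1 hWe h (hWM j hv)
  have hvf : v ∉ f := fun h => disjoint_left.1 hWf h (hWM j hv)
  simp only [mem_insert, not_or] at hvZ
  have p1 : Pth k red u x (insert u e) := Pth.edge hur (by rw [card_insert_of_notMem hue]; omega)
    (fun h => hue (h ▸ hxm.1)) (by simp) (by simp [hxm.1])
  have p2 : Pth k red x v (insert v f) := Pth.edge hvr (by rw [card_insert_of_notMem hvf]; omega)
    (fun h => hvf (h ▸ hxm.2)) (by simp [hxm.2]) (by simp)
  have p := p1.trans p2 (by
    intro y hy hy'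
    rw [mem_insert] at hy hy'
    rcases hy with rfl | hy
    · rcases hy' with h | h
      · exact absurd h.symm hvZ.1
      · exact absurd h huf
    · rcases hy' with h | h
      · exact absurd (h ▸ hy) hve
      · have : y ∈ e ∩ f := mem_inter.2 ⟨hy, h⟩
        rwa [hx, mem_singleton] at this)
  refine ⟨u, hu, v, hv, {u, v}, ?_, ?_, ?_, ?_⟩
  · intro y hy
    simp only [mem_insert, mem_singleton] at hy
    rcases hy with rfl | rfl
    · exact hWM i hu
    · exact hWM j hv
  · rw [disjoint_left]
    intro y hy
    simp only [mem_insert, mem_singleton] at hy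
    rcases hy with rfl | rfl
    · exact huZ
    · exact hvZ.2
  · have := card_le_two (a := u) (b := v); omega
  · convert p using 1
    ext y; simp only [mem_union, mem_insert, mem_singleton]; tauto

end

lemma exact_phase {k : ℕ} (hk : 3 ≤ k) (m ρ σ K1 : ℕ) : ∃ c2 L : ℕ,
    ∀ (V : Type) [Fintype V] [DecidableEq V] (red : Finset V → Prop) (n : ℕ),
      (k - 1) ∣ n → 2 * (k - 1) ≤ n → ¬ HasCyc k red n → 1 ≤ ρ →
      ρ * (n - 1) + ρ * (ρ - 1) * (2 * k) + tauFn (k - 1) σ + 1 ≤ Fintype.card V →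
      ∀ W E : Fin ρ → Finset V, (∀ i, L ≤ (W i).card) →
      (∀ i, Clq k red (W i)) → (∀ i j, i ≠ j → Disjoint (W i) (W j)) →
      (∀ e : Finset V, e.card = k → (∀ v ∈ e, ∃ i, v ∈ W i) → (∀ i, ¬ e ⊆ W i) → ¬ red e) →
      Apx k red n m K1 c2 W E →
      (∀ I : Finset V, I.card = σ → ∀ W' : Fin ρ → Finset V, (∀ i j, i ≠ j → Disjoint (W' i) (W' j)) →
        (∀ i, Disjoint I (W' i)) → (∀ i, m ≤ (W' i).card) →
        (∀ e : Finset V, e.card = k → (∀ v ∈ e, v ∈ I ∨ ∃ i, v ∈ W' i) → ¬ e ⊆ I → (∀ i, ¬ e ⊆ W' i) → ¬ red e) →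
        False) → False := by
  set z := ρ * K1 + (K1 + 1) * k with hz
  set c2 := (K1 + K1 * k + K1 * k) + (6 * k + ((K1 + 1) * (k - 1) + 1) + k) with hc2
  set L := (ρ * K1 + 6 * k + ((K1 + 1) * (k - 1) + 1)) + (m + 2 ^ σ * (ρ * (ρ * z + (z + 1)))) with hL
  refine ⟨c2, L, ?_⟩
  intro V _ _ red n hdvd hn2 hnc hρ hV W E hWL hWcl hWd hWcr hApx hI
  obtain ⟨⟨g, hg⟩, hEd, hint, hUc⟩ := hApx
  set M := univ.biUnion W with hM
  set EU := univ.biUnion E with hEU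
  set U := univ \ univ.biUnion (fun i => W i ∪ E i) with hU
  have hEi : ∀ i, E i ⊆ EU := fun i => subset_biUnion_of_mem E (mem_univ i)
  have hWM : ∀ i, W i ⊆ M := fun i => subset_biUnion_of_mem W (mem_univ i)
  have hUM : Disjoint U M := by
    rw [disjoint_left]
    intro v hv hvM
    obtain ⟨i, -, hi⟩ := mem_biUnion.1 hvM
    simp only [hU, mem_sdiff, mem_univ, true_and, mem_biUnion, mem_union, not_exists, not_or] at hv
    exact (hv i).1 hi
  have hUE : Disjoint U EU := by
    rw [disjoint_left]
    intro v hv hvM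
    obtain ⟨i, -, hi⟩ := mem_biUnion.1 hvM
    simp only [hU, mem_sdiff, mem_univ, true_and, mem_biUnion, mem_union, not_exists, not_or] at hv
    exact (hv i).2 hi
  set Z := EU ∩ M with hZ
  have hZc : Z.card ≤ ρ * K1 := by
    have : Z ⊆ univ.biUnion (fun i => EU ∩ W i) := by
      intro v hv
      obtain ⟨h1, h2⟩ := mem_inter.1 hv
      obtain ⟨i, -, hi⟩ := mem_biUnion.1 h2
      exact mem_biUnion.2 ⟨i, mem_univ _, mem_inter.2 ⟨h1, hi⟩⟩
    refine (card_le_card this).trans ((card_biUnion_le_card_mul _ _ K1 (fun i _ => hint i)).trans (by simp))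
  have hDE : ∀ D : Finset V, D ⊆ U ∪ (M \ Z) → Disjoint D EU := by
    intro D hD
    rw [disjoint_left]
    intro v hv hvE
    rcases mem_union.1 (hD hv) with h | h
    · exact disjoint_left.1 hUE h hvE
    · exact (mem_sdiff.1 h).2 (mem_inter.2 ⟨hvE, (mem_sdiff.1 h).1⟩)
  have hgain : ∀ (i : Fin ρ) (g' : ℕ) (D : Finset V), ES k red (W i) g' D → D ⊆ U ∪ (M \ Z) →
      D.card + g' * (k - 2) ≤ c2 → (W i \ EU).card + (E i).card + (D \ W i).card ≤ n - 1 :=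
    fun i g' D h1 h2 h3 => gain hk hdvd hn2 hnc (hWcl i) (hg i).1 (hEi i) (hg i).2.2 h1 (hDE D h2) h3
  have hbase : ∀ i, (W i \ EU).card + (E i).card ≤ n - 1 := by
    intro i
    have := hgain i 0 ∅ ES.nil (by simp) (by simp)
    simpa using this
  have hcov : Fintype.card V ≤ U.card + ∑ i, ((W i \ EU).card + (E i).card) := by
    have : (univ : Finset V) ⊆ U ∪ univ.biUnion (fun i => (W i \ EU) ∪ E i) := by
      intro v _
      by_cases hvE : v ∈ EU
      · obtain ⟨i, -, hi⟩ := mem_biUnion.1 hvE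
        exact mem_union.2 (Or.inr (mem_biUnion.2 ⟨i, mem_univ _, mem_union.2 (Or.inr hi)⟩))
      · by_cases hvU : v ∈ U
        · exact mem_union.2 (Or.inl hvU)
        · simp only [hU, mem_sdiff, mem_univ, true_and, not_not, mem_biUnion] at hvU
          obtain ⟨i, hi⟩ := hvU
          refine mem_union.2 (Or.inr (mem_biUnion.2 ⟨i, mem_univ _, ?_⟩))
          rcases mem_union.1 hi with h | h
          · exact mem_union.2 (Or.inl (mem_sdiff.2 ⟨h, hvE⟩))
          · exact mem_union.2 (Or.inr h)
    rw [← card_univ]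
    refine (card_le_card this).trans ((card_union_le _ _).trans (Nat.add_le_add_left ?_ _))
    exact card_biUnion_le.trans (sum_le_sum (fun i _ => card_union_le _ _))
  -- no two disjoint connectors
  have hno2 : ∀ i j, i ≠ j → ∀ S ⊆ U, ∀ S' ⊆ U, S.card ≤ 2 * k → S'.card ≤ 2 * k → Disjoint S S' →
      Con k red W z i j S → ¬ Con k red W z i j S' := by
    intro i j hij S hS S' hS' hSc hSc' hSS h h'
    have hexp : (K1 + 1) * k = K1 * k + k := by ring
    obtain ⟨D, h1, h2, h3, h4⟩ := excursion (N := K1 + 1) (Z := Z) hk (by omega) hij hWd (hWcl j) h h' hSS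
      (disjoint_of_subset_left hS hUM) (disjoint_of_subset_left hS' hUM) hSc hSc' (by omega)
      (by have := hWL j; omega)
    have := hgain i 1 D h1 (h2.trans (union_subset_union_left (union_subset hS hS'))) (by omega)
    have hs := sum_erase_add (s := univ) (f := fun i => (W i \ EU).card + (E i).card) (mem_univ i)
    have hs2 : ∑ x ∈ univ.erase i, ((W x \ EU).card + (E x).card) ≤ (ρ - 1) * (n - 1) := by
      refine (sum_le_card_nsmul _ _ (n - 1) (fun x _ => hbase x)).trans ?_
      simp
    have hs3 : ρ * (n - 1) = (ρ - 1) * (n - 1) + (n - 1) := by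
      obtain ⟨a, rfl⟩ : ∃ a, ρ = a + 1 := ⟨ρ - 1, by omega⟩
      simp; ring
    omega
  -- choose connectors
  have hC : ∀ p : Fin ρ × Fin ρ, ∃ C ⊆ U, C.card ≤ 2 * k ∧ (p.1 ≠ p.2 → ∀ S ⊆ U \ C, S.card ≤ 2 * k →
      ¬ Con k red W z p.1 p.2 S) := by
    intro p
    by_cases hex : p.1 ≠ p.2 ∧ ∃ C ⊆ U, C.card ≤ 2 * k ∧ Con k red W z p.1 p.2 C
    · obtain ⟨hne, C, hCU, hCc, hC⟩ := hex
      refine ⟨C, hCU, hCc, fun _ S hS hSc => hno2 p.1 p.2 hne C hCU S (hS.trans sdiff_subset) hCc hSc ?_ hC⟩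
      exact disjoint_of_subset_right hS disjoint_sdiff
    · refine ⟨∅, by simp, by simp, fun hne S hS hSc hcon => hex ⟨hne, S, hS.trans sdiff_subset, hSc, hcon⟩⟩
  choose C hCU hCc hC using hC
  set CC := (univ : Finset (Fin ρ)).offDiag.biUnion C with hCC
  have hCCc : CC.card ≤ ρ * (ρ - 1) * (2 * k) := by
    refine (card_biUnion_le_card_mul _ _ (2 * k) (fun p _ => hCc p)).trans ?_
    rw [offDiag_card]
    simp [Nat.mul_sub]
  have hconU1 : ∀ i j, i ≠ j → ∀ S ⊆ U \ CC, S.card ≤ 2 * k → ¬ Con k red W z i j S := by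
    intro i j hij S hS hSc
    refine hC (i, j) hij S (hS.trans (sdiff_subset_sdiff subset_rfl ?_)) hSc
    exact subset_biUnion_of_mem C (by simp [hij])
  obtain ⟨R, t, U', hUU, hU'U, hRU, hAS, hnoabs⟩ := split_abs (k := k) (red := red) W z _ (U \ CC) rfl
  have hRgain : ∀ i, (W i \ EU).card + (E i).card + (R i).card ≤ n - 1 := by
    intro i
    have hRi : R i ⊆ U := (hRU i).trans sdiff_subset
    have hRM : Disjoint (R i) M := disjoint_of_subset_left hRi hUM
    have hRK : (R i).card ≤ K1 := (card_le_card hRi).trans hUc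
    have htK := (hAS i).le_card.trans hRK
    have m1 : t i * k ≤ K1 * k := Nat.mul_le_mul_right _ htK
    have m2 : t i * (k - 2) ≤ t i * k := Nat.mul_le_mul_left _ (by omega)
    have hexp : (K1 + 1) * k = K1 * k + k := by ring
    obtain ⟨D, h1, h2, h3, h4⟩ := (hAS i).real Z (by omega) hRM
    have := hgain i (t i) D h1 (h3.trans (union_subset_union_left hRi)) (by omega)
    have hsub : R i ⊆ D \ W i := by
      intro v hv
      exact mem_sdiff.2 ⟨h2 hv, fun h => disjoint_left.1 hRM hv (hWM i h)⟩
    have := card_le_card hsub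
    omega
  have hU'c : tauFn (k - 1) σ + 1 ≤ U'.card := by
    have a1 : U.card ≤ CC.card + (U' ∪ univ.biUnion R).card := by
      refine (card_le_card ?_).trans (card_union_le CC (U' ∪ univ.biUnion R))
      intro v hv
      by_cases h : v ∈ CC
      · exact mem_union_left _ h
      · exact mem_union_right _ (hUU (mem_sdiff.2 ⟨hv, h⟩))
    have a2 := card_union_le U' (univ.biUnion R)
    have a3 : (univ.biUnion R).card ≤ ∑ i, (R i).card := card_biUnion_le
    have a4 : ∑ i, ((W i \ EU).card + (E i).card) + ∑ i, (R i).card ≤ ρ * (n - 1) := by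
      rw [← sum_add_distrib]
      refine (sum_le_card_nsmul _ _ (n - 1) (fun x _ => hRgain x)).trans ?_
      simp
    omega
  have hU'U' : U' ⊆ U := hU'U.trans sdiff_subset
  have hConU' : ∀ i j, ∀ S ⊆ U', S.Nonempty → S.card ≤ 2 * k → ¬ Con k red W z i j S := by
    intro i j S hS hne hSc
    by_cases hij : i = j
    · subst hij; exact hnoabs i S hS hne
    · exact hconU1 i j hij S (hS.trans hU'U) hSc
  obtain ⟨I, hIU, hIc, hIF⟩ := tau_prop hk U' hU'c
    (fun S => ∃ i, ∀ Z : Finset V, Z.card ≤ z + 1 → ∃ v ∈ W i, v ∉ Z ∧ red (insert v S)) (by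
      rintro e he f hf hec hfc ⟨i, hi⟩ ⟨j, hj⟩ - hef
      refine hConU' i j (e ∪ f) (union_subset he hf) ?_ ?_
        (no_loose hk hec hfc hef (disjoint_of_subset_left (he.trans hU'U') hUM)
          (disjoint_of_subset_left (hf.trans hU'U') hUM) hi hj)
      · have : 0 < e.card := by omega
        exact (card_pos.1 this).mono subset_union_left
      · have := card_union_le e f; omega)
  obtain ⟨W', q1, q2, q3, q4⟩ := block (m := m) hk hWd hWcr (disjoint_of_subset_left (hIU.trans hU'U') hUM)
    (fun i j S hS => hConU' i j S (hS.trans hIU)) hIF (fun i => by rw [hIc]; have := hWL i; omega)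
  exact hI I hIc W' q1 q2 q3 q4

end LC

namespace LC
open Finset

lemma core {k : ℕ} (hk : 3 ≤ k) (m ρ σ : ℕ) (hρ : 1 ≤ ρ) : ∀ r ≤ ρ + 1, ∀ q : ℕ, ∃ n1 : ℕ,
    ∀ (V : Type) [Fintype V] [DecidableEq V] (red : Finset V → Prop) (n : ℕ), n1 ≤ n →
      (k - 1) ∣ n → ¬ HasCyc k red n →
      (∀ S : Finset V, m ≤ S.card → ∃ e ⊆ S, e.card = k ∧ red e) →
      ρ * (n - 1) + ρ * (ρ - 1) * (2 * k) + tauFn (k - 1) σ + 1 ≤ Fintype.card V →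
      (∀ I : Finset V, I.card = σ → ∀ W' : Fin ρ → Finset V, (∀ i j, i ≠ j → Disjoint (W' i) (W' j)) →
        (∀ i, Disjoint I (W' i)) → (∀ i, m ≤ (W' i).card) →
        (∀ e : Finset V, e.card = k → (∀ v ∈ e, v ∈ I ∨ ∃ i, v ∈ W' i) → ¬ e ⊆ I → (∀ i, ¬ e ⊆ W' i) → ¬ red e) →
        False) → BX k red r q := by
  intro r
  induction r with
  | zero =>
    intro _ q
    refine ⟨0, fun V _ _ red n _ _ _ _ _ _ => ⟨fun i => i.elim0, fun i => i.elim0, fun i => i.elim0,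
      fun i => i.elim0, fun e he hv => ?_⟩⟩
    obtain ⟨v, hv'⟩ := card_pos.1 (by omega : 0 < e.card)
    obtain ⟨i, _⟩ := hv v hv'
    exact i.elim0
  | succ r ih =>
    intro hr q
    rcases Nat.eq_zero_or_pos r with rfl | hr0
    · obtain ⟨R, hR⟩ := ramsey_ex k q m
      refine ⟨R + 1, fun V _ _ red n hn _ _ hF hV _ => ?_⟩
      have h1 : 1 * (n - 1) ≤ ρ * (n - 1) := Nat.mul_le_mul_right _ hρ
      rcases hR V red univ (by rw [card_univ]; omega) with ⟨Q, -, hQ, hQc⟩ | ⟨M, -, hM, hMb⟩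
      · refine ⟨fun _ => Q, fun _ => hQ.ge, fun _ => hQc, fun i j hij => absurd (Subsingleton.elim (α := Fin 1) i j) hij, ?_⟩
        intro e _ hv hne
        exact absurd (fun v hv' => (hv v hv').choose_spec) (hne 0)
      · obtain ⟨e, he, hec, her⟩ := hF M hM.ge
        exact absurd her (hMb e he hec)
    · obtain ⟨K1, hK1⟩ := approx hk m ρ r (max q k) hr0 (by omega) (le_max_right _ _)
      obtain ⟨c2, L1, hex⟩ := exact_phase hk m ρ σ K1
      obtain ⟨L2, n2, hap⟩ := hK1 c2
      obtain ⟨n3, hih⟩ := ih (by omega) (max L1 L2)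
      refine ⟨n2 + n3 + 2 * (k - 1), fun V _ _ red n hn hdvd hnc hF hV hI => ?_⟩
      obtain ⟨W, hWL, hWcl, hWd, hWcr⟩ := hih V red n (by omega) hdvd hnc hF hV hI
      by_contra hB
      have hB' : ¬ BX k red (r + 1) (max q k) := by
        rintro ⟨W, h1, h2⟩
        exact hB ⟨W, fun i => (le_max_left _ _).trans (h1 i), h2⟩
      obtain ⟨rfl, E, hE⟩ := hap V red n (by omega) hdvd hnc hF (by omega) W
        (fun i => (le_max_right _ _).trans (hWL i)) hWcl hWd hWcr hB'
      exact hex V red n hdvd (by omega) hnc hρ hV W E (fun i => (le_max_left _ _).trans (hWL i)) hWcl hWd hWcr hE hI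

lemma main_lem {k : ℕ} (hk : 3 ≤ k) (m ρ σ : ℕ) (hρ : 1 ≤ ρ) : ∃ n1 : ℕ,
    ∀ (V : Type) [Fintype V] [DecidableEq V] (red : Finset V → Prop) (n : ℕ), n1 ≤ n →
      (k - 1) ∣ n → ¬ HasCyc k red n →
      (∀ S : Finset V, m ≤ S.card → ∃ e ⊆ S, e.card = k ∧ red e) →
      ρ * (n - 1) + ρ * (ρ - 1) * (2 * k) + tauFn (k - 1) σ + 1 ≤ Fintype.card V →
      (∀ I : Finset V, I.card = σ → ∀ W' : Fin ρ → Finset V, (∀ i j, i ≠ j → Disjoint (W' i) (W' j)) →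
        (∀ i, Disjoint I (W' i)) → (∀ i, m ≤ (W' i).card) →
        (∀ e : Finset V, e.card = k → (∀ v ∈ e, v ∈ I ∨ ∃ i, v ∈ W' i) → ¬ e ⊆ I → (∀ i, ¬ e ⊆ W' i) → ¬ red e) →
        False) → False := by
  obtain ⟨n1, h⟩ := core hk m ρ σ hρ (ρ + 1) le_rfl (max m σ)
  refine ⟨n1, fun V _ _ red n hn hdvd hnc hF hV hI => ?_⟩
  obtain ⟨W, hWL, hWcl, hWd, hWcr⟩ := h V red n hn hdvd hnc hF hV hI
  obtain ⟨I, hIW, hIc⟩ := exists_subset_card_eq ((le_max_right m σ).trans (hWL (Fin.last ρ)))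
  have hne : ∀ i : Fin ρ, Fin.last ρ ≠ i.castSucc := fun i => (Fin.castSucc_lt_last i).ne'
  refine hI I hIc (fun i => W i.castSucc) (fun i j hij => hWd _ _ (fun h => hij (Fin.castSucc_injective _ h)))
    (fun i => disjoint_of_subset_left hIW (hWd _ _ (hne i)))
    (fun i => (le_max_left _ _).trans (hWL _)) ?_
  intro e he hv heI heW
  refine hWcr e he (fun v hv' => ?_) (fun i => ?_)
  · rcases hv v hv' with h | ⟨i, h⟩
    · exact ⟨_, hIW h⟩
    · exact ⟨_, h⟩
  · induction i using Fin.lastCases with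
    | cast i => exact heW i
    | last =>
      intro hsub
      apply heI
      intro v hv'
      rcases hv v hv' with h | ⟨i, h⟩
      · exact h
      · exact absurd h (disjoint_left.1 (hWd _ _ (hne i)) (hsub hv'))

end LC

theorem looseCycle_upper {k nH : ℕ} (hk : 3 ≤ k)
    (H : Finset (Finset (Fin nH))) (hHu : IsUniformHyp k H) :
    ∃ n₀ : ℕ, ∀ n : ℕ, n₀ ≤ n → n ≡ 0 [MOD k - 1] →
      ramseyNumber (ellCycleEdges k 1 n) H ≤
        (chromNum H - 1) * (n - 1) + 4 * k * Nat.choose (chromNum H - 1) 2 +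
          tauFn (k - 1) (sigmaNum H) + 1 := by
  rcases Nat.eq_zero_or_pos nH with rfl | hn0
  · refine ⟨0, fun n _ _ => Nat.sInf_le ?_⟩
    intro c
    right
    refine ⟨fun i => i.elim0, fun i => i.elim0, fun e he => ?_⟩
    have h1 := hHu e he
    have h2 := Finset.card_le_univ e
    simp at h2
    simp [h2] at h1
    omega
  obtain ⟨hχ, hF2⟩ := LC.F2 (V := Fin 0) hk hn0 hHu
  clear hF2
  rcases Nat.eq_zero_or_pos (chromNum H - 1) with h0 | hρ
  · refine ⟨0, fun n _ _ => Nat.sInf_le ?_⟩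
    intro c
    by_contra hno
    push Not at hno
    obtain ⟨-, hF2⟩ := LC.F2 (V := Fin ((chromNum H - 1) * (n - 1) + 4 * k * Nat.choose (chromNum H - 1) 2 +
          tauFn (k - 1) (sigmaNum H) + 1)) hk hn0 hHu
    obtain ⟨I, -, hIc, -⟩ := LC.tau_prop (σ := sigmaNum H) hk (Finset.univ : Finset (Fin ((chromNum H - 1) * (n - 1) + 4 * k * Nat.choose (chromNum H - 1) 2 +
          tauFn (k - 1) (sigmaNum H) + 1))) (by simp) (fun _ => False) (by simp)
    have hemp : ∀ i : Fin (chromNum H - 1), False := fun i => by have := i.2; omega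
    refine hF2 hno.2 I hIc (fun _ => ∅) (fun i => (hemp i).elim) (fun i => (hemp i).elim) (fun i => (hemp i).elim) ?_
    intro e _ hv hne
    refine absurd (fun v hv' => ?_) hne
    rcases hv v hv' with h | ⟨i, _⟩
    · exact h
    · exact (hemp i).elim
  · obtain ⟨n1, hmain⟩ := LC.main_lem hk nH (chromNum H - 1) (sigmaNum H) hρ
    refine ⟨n1, fun n hn hmod => Nat.sInf_le ?_⟩
    have hdvd : (k - 1) ∣ n := (Nat.modEq_zero_iff_dvd).1 hmod
    intro c
    by_contra hno
    push Not at hno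
    refine hmain _ (fun e => c e = true) n hn hdvd (fun h => hno.1 (h.copy hk hdvd)) ?_ ?_ ?_
    · intro S hS
      exact LC.F1 hHu hno.2 S hS
    · rw [Fintype.card_fin]
      have he : 2 * Nat.choose (chromNum H - 1) 2 = (chromNum H - 1) * ((chromNum H - 1) - 1) := by
        rw [Nat.choose_two_right]
        exact Nat.two_mul_div_two_of_even (Nat.even_mul_pred_self _)
      rw [← he]
      apply le_of_eq
      ring
    · intro I hI W' h1 h2 h3 h4
      refine (LC.F2 hk hn0 hHu).2 hno.2 I hI W' h1 h2 h3 ?_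
      intro e a1 a2 a3 a4
      have := h4 e a1 a2 a3 a4
      simpa using this
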